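/- arXiv:2008.10552 — 7 statements merged into one kernel-verified Lean document; each statement's English description precedes it below -/
import Mathlib

section
/- Let Δ be a (v,b,r,k)-design with r > 1, and suppose there is a positive integer μ such that every pair of distinct non-disjoint blocks of Δ intersect in exactly μ treatments. Then equality η₀(Δ) = v(v − k − (r−1)(k−μ))/2 holds if and only if η₁(Δ) = vr(k−μ)/2, η_r(Δ) = v(μ−1)/2, and η_i(Δ) = 0 for all i with 2 ≤ i ≤ r−1; that is, if and only if η(Δ) = (v(v−k−(r−1)(k−μ))/2, vr(k−μ)/2, 0, …, 0, v(μ−1)/2). -/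
open Polynomial

/-- A `(v,b,r,k)`-design: `b` blocks (indexed by `Fin b`, so repeated blocks are allowed),
each a `k`-subset of the `v` treatments, with each treatment in exactly `r` blocks. -/
structure BlockDesign (v b r k : ℕ) where
  blocks : Fin b → Finset (Fin v)
  blockSize : ∀ j, (blocks j).card = k
  replication : ∀ α : Fin v, (Finset.univ.filter fun j => α ∈ blocks j).card = r

namespace BlockDesign

variable {v b r k : ℕ}

/-- The concurrence of two treatments: the number of blocks containing both. -/
def concurrence (D : BlockDesign v b r k) (α β : Fin v) : ℕ :=
  (Finset.univ.filter fun j => α ∈ D.blocks j ∧ β ∈ D.blocks j).card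

/-- The scaled information matrix `F(Δ) = I − (rk)⁻¹ Λ`. -/
noncomputable def infoMatrix (D : BlockDesign v b r k) : Matrix (Fin v) (Fin v) ℝ :=
  1 - ((r : ℝ) * (k : ℝ))⁻¹ • Matrix.of (fun α β => (D.concurrence α β : ℝ))

/-- `η_i(Δ)`: the number of unordered pairs of distinct treatments with concurrence `i`. -/
def eta (D : BlockDesign v b r k) (i : ℕ) : ℕ :=
  (Finset.univ.filter fun p : Fin v × Fin v => p.1 < p.2 ∧ D.concurrence p.1 p.2 = i).card

/-- `π : Fin b → Fin r` assigns blocks to parallel classes, each class partitioning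
the treatment set. -/
def IsResolution (D : BlockDesign v b r k) (π : Fin b → Fin r) : Prop :=
  ∀ (c : Fin r) (α : Fin v), ∃! j : Fin b, π j = c ∧ α ∈ D.blocks j

def IsResolvable (D : BlockDesign v b r k) : Prop :=
  k < v ∧ 1 < r ∧ ∃ π : Fin b → Fin r, D.IsResolution π

def IsAffineResolvable (D : BlockDesign v b r k) : Prop :=
  k < v ∧ 1 < r ∧ ∃ π : Fin b → Fin r, D.IsResolution π ∧
    ∃ μ : ℕ, 0 < μ ∧ ∀ j j' : Fin b, π j ≠ π j' → (D.blocks j ∩ D.blocks j').card = μ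

/-- The canonical efficiency factors, as a multiset: the eigenvalues (with multiplicity,
i.e. the roots of the characteristic polynomial) of the scaled information matrix,
with one copy of the eigenvalue `0` removed. -/
noncomputable def effFactors (D : BlockDesign v b r k) : Multiset ℝ :=
  (D.infoMatrix.charpoly.roots).erase 0

/-- The canonical efficiency factors, sorted increasingly. -/
noncomputable def sortedEff (D : BlockDesign v b r k) : List ℝ :=
  D.effFactors.sort (· ≤ ·)

/-- `D` is Schur optimal in a class `C` of `(v,b,r,k)`-designs. -/
def SchurOptimalIn (D : BlockDesign v b r k) (C : Set (BlockDesign v b r k)) : Prop :=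
  D ∈ C ∧ ∀ Γ ∈ C, ∀ ℓ : ℕ, 1 ≤ ℓ → ℓ ≤ v - 1 →
    ((Γ.sortedEff).take ℓ).sum ≤ ((D.sortedEff).take ℓ).sum

/-- `D` is an `s`-fold inflation of `E`. -/
def IsInflation (s : ℕ) {w m : ℕ} (D : BlockDesign v b r k) (E : BlockDesign w b r m) : Prop :=
  ∃ e : Fin v ≃ Fin w × Fin s, ∀ (α : Fin v) (j : Fin b), α ∈ D.blocks j ↔ (e α).1 ∈ E.blocks j

/-- `D` is a `(v,b,r,k,λ)`-balanced incomplete-block design. -/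
def IsBIBD (D : BlockDesign v b r k) (lam : ℕ) : Prop :=
  1 < k ∧ k < v ∧ ∀ α β : Fin v, α ≠ β → D.concurrence α β = lam

end BlockDesign

/-- An `(n×n)/k` semi-Latin square. -/
structure SemiLatinSquare (n k : ℕ) where
  block : Fin n → Fin n → Finset (Fin (n * k))
  blockSize : ∀ i j, (block i j).card = k
  row_once : ∀ (i : Fin n) (α : Fin (n * k)), ∃! j : Fin n, α ∈ block i j
  col_once : ∀ (j : Fin n) (α : Fin (n * k)), ∃! i : Fin n, α ∈ block i j

namespace SemiLatinSquare

variable {n k : ℕ}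

/-- `S` is uniform with intersection parameter `μ`. -/
def UniformWith (S : SemiLatinSquare n k) (μ : ℕ) : Prop :=
  0 < μ ∧ ∀ i j i' j' : Fin n, i ≠ i' → j ≠ j' →
    (S.block i j ∩ S.block i' j').card = μ

def IsUniform (S : SemiLatinSquare n k) : Prop := ∃ μ : ℕ, S.UniformWith μ

/-- Concurrence in the underlying block design of `S`. -/
def concurrence (S : SemiLatinSquare n k) (α β : Fin (n * k)) : ℕ :=
  (Finset.univ.filter fun p : Fin n × Fin n =>
    α ∈ S.block p.1 p.2 ∧ β ∈ S.block p.1 p.2).card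

/-- The scaled information matrix of the underlying block design of `S`
(which is an `(nk, n², n, k)`-design, so `rk = nk`). -/
noncomputable def infoMatrix (S : SemiLatinSquare n k) :
    Matrix (Fin (n * k)) (Fin (n * k)) ℝ :=
  1 - ((n : ℝ) * (k : ℝ))⁻¹ • Matrix.of (fun α β => (S.concurrence α β : ℝ))

/-- `η_i(S)`: the number of unordered pairs of distinct treatments with concurrence `i`. -/
def eta (S : SemiLatinSquare n k) (i : ℕ) : ℕ :=
  (Finset.univ.filter fun p : Fin (n * k) × Fin (n * k) =>
    p.1 < p.2 ∧ S.concurrence p.1 p.2 = i).card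

/-- Canonical efficiency factors of `S` (eigenvalues of the scaled information matrix,
with multiplicity, after removing one copy of `0`). -/
noncomputable def effFactors (S : SemiLatinSquare n k) : Multiset ℝ :=
  (S.infoMatrix.charpoly.roots).erase 0

noncomputable def sortedEff (S : SemiLatinSquare n k) : List ℝ :=
  S.effFactors.sort (· ≤ ·)

/-- `S` is Schur optimal in the class of all `(n×n)/k` semi-Latin squares
(on the same treatment set). -/
def SchurOptimal (S : SemiLatinSquare n k) : Prop :=
  ∀ T : SemiLatinSquare n k, ∀ ℓ : ℕ, 1 ≤ ℓ → ℓ ≤ n * k - 1 →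
    ((T.sortedEff).take ℓ).sum ≤ ((S.sortedEff).take ℓ).sum

/-- `S` is an `s`-fold inflation of `T`. -/
def IsInflation (s : ℕ) (S : SemiLatinSquare n (s * k)) (T : SemiLatinSquare n k) : Prop :=
  ∃ e : Fin (n * (s * k)) ≃ Fin (n * k) × Fin s,
    ∀ (α : Fin (n * (s * k))) (i j : Fin n), α ∈ S.block i j ↔ (e α).1 ∈ T.block i j

/-- The PV-aberration vector `(η₀(S), …, η_n(S))`. -/
def etaVec (S : SemiLatinSquare n k) : List ℕ :=
  (List.range (n + 1)).map (S.eta)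

/-- `S` has minimum PV aberration in the class of uniform `(n×n)/k` semi-Latin squares:
no uniform square has a lexicographically smaller `η`-vector. -/
def MinPVAberration (S : SemiLatinSquare n k) : Prop :=
  ∀ T : SemiLatinSquare n k, T.IsUniform → ¬ List.Lex (· < ·) (T.etaVec) (S.etaVec)

end SemiLatinSquare

/-- `L` is a Latin square of order `n` (symbols `Fin n`). -/
def IsLatin (n : ℕ) (L : Fin n → Fin n → Fin n) : Prop :=
  (∀ (i a : Fin n), ∃! j : Fin n, L i j = a) ∧ (∀ (j a : Fin n), ∃! i : Fin n, L i j = a)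

/-- Two Latin squares of order `n` are orthogonal: each pair of symbols occurs together
in exactly one cell of the superposition. -/
def AreOrthogonal {n : ℕ} (L M : Fin n → Fin n → Fin n) : Prop :=
  ∀ a b : Fin n, ∃! p : Fin n × Fin n, L p.1 p.2 = a ∧ M p.1 p.2 = b

/-- A family of mutually orthogonal Latin squares of order `n`. -/
def IsMOLS {n m : ℕ} (L : Fin m → Fin n → Fin n → Fin n) : Prop :=
  (∀ t, IsLatin n (L t)) ∧ ∀ t t', t ≠ t' → AreOrthogonal (L t) (L t')

/-- `S` is a `μ`-fold inflation of a superposition of `n−1` mutually orthogonal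
Latin squares of order `n` (with pairwise disjoint symbol sets): the treatments of `S`
are identified with triples `((t, a), c)` where `t` indexes the Latin square, `a` is a
symbol, and `c` is the inflation index, and treatment `((t,a),c)` lies in block `(i,j)`
iff Latin square `t` has symbol `a` in cell `(i,j)`. -/
def SemiLatinSquare.IsInflatedMOLSSuperposition {n k : ℕ} (μ : ℕ)
    (S : SemiLatinSquare n k) : Prop :=
  ∃ L : Fin (n - 1) → Fin n → Fin n → Fin n, IsMOLS L ∧
    ∃ e : Fin (n * k) ≃ (Fin (n - 1) × Fin n) × Fin μ,
      ∀ (α : Fin (n * k)) (i j : Fin n),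
        α ∈ S.block i j ↔ L (e α).1.1 i j = (e α).1.2

namespace BlockDesign

variable {v b r k : ℕ}

def inc (D : BlockDesign v b r k) (α : Fin v) (j : Fin b) : ℚ :=
  if α ∈ D.blocks j then 1 else 0

lemma sum_inc_left (D : BlockDesign v b r k) (j : Fin b) : ∑ α, D.inc α j = k := by
  simp [inc, D.blockSize j]

lemma sum_inc_right (D : BlockDesign v b r k) (α : Fin v) : ∑ j, D.inc α j = r := by
  simp only [inc, Finset.sum_boole, D.replication α]

lemma conc_eq (D : BlockDesign v b r k) (α β : Fin v) :
    (D.concurrence α β : ℚ) = ∑ j, D.inc α j * D.inc β j := by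
  have : ∀ j, D.inc α j * D.inc β j = if α ∈ D.blocks j ∧ β ∈ D.blocks j then 1 else 0 := by
    intro j; unfold inc; split_ifs <;> simp_all
  simp only [this, Finset.sum_boole, concurrence]

lemma conc_symm (D : BlockDesign v b r k) (α β : Fin v) :
    D.concurrence α β = D.concurrence β α := by
  simp only [concurrence, and_comm]

lemma conc_self (D : BlockDesign v b r k) (α : Fin v) : D.concurrence α α = r := by
  simp only [concurrence, and_self, D.replication α]

lemma conc_le (D : BlockDesign v b r k) (α β : Fin v) : D.concurrence α β ≤ r := by
  refine le_trans (Finset.card_le_card ?_) (D.replication α).le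
  intro j
  simp only [Finset.mem_filter]
  tauto

lemma sum_conc (D : BlockDesign v b r k) (α : Fin v) :
    ∑ β, (D.concurrence α β : ℚ) = r * k := by
  simp only [conc_eq]
  rw [Finset.sum_comm]
  simp only [← Finset.mul_sum, sum_inc_left]
  rw [← Finset.sum_mul, sum_inc_right]

lemma sum_conc_sq (D : BlockDesign v b r k) (μ : ℕ)
    (hint : ∀ j j' : Fin b, j ≠ j' → (D.blocks j ∩ D.blocks j').Nonempty →
      (D.blocks j ∩ D.blocks j').card = μ) (α : Fin v) :
    ∑ β, (D.concurrence α β : ℚ) ^ 2 = μ * r * r + (k - μ) * r := by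
  have h1 : ∀ j j', ∑ β, D.inc β j * D.inc β j' = ((D.blocks j ∩ D.blocks j').card : ℚ) := by
    intro j j'
    have : ∀ β, D.inc β j * D.inc β j' = if β ∈ D.blocks j ∩ D.blocks j' then 1 else 0 := by
      intro β; unfold inc; split_ifs <;> simp_all
    simp only [this, Finset.sum_boole, Finset.filter_univ_mem]
  have h2 : ∀ j j', D.inc α j * D.inc α j' * ((D.blocks j ∩ D.blocks j').card : ℚ)
      = μ * D.inc α j * D.inc α j' + if j = j' then (k - μ) * D.inc α j else 0 := by
    intro j j'
    by_cases a : α ∈ D.blocks j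
    · by_cases c : α ∈ D.blocks j'
      · by_cases e : j = j'
        · subst e
          simp [inc, a, D.blockSize]
        · rw [hint j j' e ⟨α, by simp [a, c]⟩]
          simp [inc, a, c, e]
      · have e : j ≠ j' := by rintro rfl; exact c a
        simp [inc, a, c, e]
    · simp [inc, a]
  calc ∑ β, (D.concurrence α β : ℚ) ^ 2
      = ∑ β, ∑ j, ∑ j', D.inc α j * D.inc α j' * (D.inc β j * D.inc β j') := by
        refine Finset.sum_congr rfl fun β _ => ?_
        rw [conc_eq, sq, Finset.sum_mul_sum]
        refine Finset.sum_congr rfl fun j _ => Finset.sum_congr rfl fun j' _ => ?_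
        ring
    _ = ∑ j, ∑ j', D.inc α j * D.inc α j' * ((D.blocks j ∩ D.blocks j').card : ℚ) := by
        rw [Finset.sum_comm]
        refine Finset.sum_congr rfl fun j _ => ?_
        rw [Finset.sum_comm]
        refine Finset.sum_congr rfl fun j' _ => ?_
        rw [← Finset.mul_sum, h1]
    _ = _ := by
        simp only [h2, Finset.sum_add_distrib, ← Finset.mul_sum, sum_inc_right,
          Finset.sum_ite_eq, Finset.mem_univ, if_true, ← Finset.sum_mul]

lemma sum_split (D : BlockDesign v b r k) (f : ℕ → ℚ) :
    ∑ α, ∑ β, f (D.concurrence α β)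
      = v * f r + 2 * ∑ i ∈ Finset.range (r + 1), f i * D.eta i := by
  have e : ∑ i ∈ Finset.range (r + 1), f i * D.eta i
      = ∑ α, ∑ β, if α < β then f (D.concurrence α β) else 0 := by
    have h : ∀ i, f i * (D.eta i : ℚ)
        = ∑ p : Fin v × Fin v, if p.1 < p.2 ∧ D.concurrence p.1 p.2 = i then f i else 0 := by
      intro i
      rw [← Finset.sum_filter, Finset.sum_const, nsmul_eq_mul, mul_comm]; rfl
    simp only [h]
    rw [Finset.sum_comm, ← Finset.univ_product_univ, Finset.sum_product]
    refine Finset.sum_congr rfl fun α _ => Finset.sum_congr rfl fun β _ => ?_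
    have := D.conc_le α β
    by_cases l : α < β
    · simp [l]; intro; omega
    · simp [l]
  have e2 : ∑ α, ∑ β, (if α < β then f (D.concurrence α β) else 0)
      = ∑ α, ∑ β, if β < α then f (D.concurrence α β) else 0 := by
    rw [Finset.sum_comm]
    refine Finset.sum_congr rfl fun α _ => Finset.sum_congr rfl fun β _ => ?_
    rw [conc_symm]
  have e3 : (v : ℚ) * f r = ∑ α : Fin v, ∑ β, if α = β then f (D.concurrence α β) else 0 := by
    simp [conc_self]
  rw [two_mul, e]
  nth_rewrite 2 [e2]
  rw [e3]
  simp only [← Finset.sum_add_distrib]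
  refine Finset.sum_congr rfl fun α _ => Finset.sum_congr rfl fun β _ => ?_
  rcases lt_trichotomy α β with h | h | h
  · simp [h, h.ne, h.not_gt]
  · simp [h]
  · simp [h, h.ne', h.not_gt]

end BlockDesign

/-- Theorem 4, equality case (η-vector form): under the hypotheses of the bound,
`η₀(D) = v(v − k − (r−1)(k−μ))/2` holds iff
`η(D) = (v(v−k−(r−1)(k−μ))/2, vr(k−μ)/2, 0, …, 0, v(μ−1)/2)`. -/
theorem eta_zero_equality_iff_eta_vector (v b r k μ : ℕ) (hv : 0 < v) (hb : 0 < b)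
    (hk : 0 < k) (hr : 1 < r) (hμ : 0 < μ) (D : BlockDesign v b r k)
    (hint : ∀ j j' : Fin b, j ≠ j' → (D.blocks j ∩ D.blocks j').Nonempty →
      (D.blocks j ∩ D.blocks j').card = μ) :
    (D.eta 0 : ℚ) = (v : ℚ) * ((v : ℚ) - (k : ℚ) - ((r : ℚ) - 1) * ((k : ℚ) - (μ : ℚ))) / 2
      ↔
    ((D.eta 0 : ℚ)
        = (v : ℚ) * ((v : ℚ) - (k : ℚ) - ((r : ℚ) - 1) * ((k : ℚ) - (μ : ℚ))) / 2 ∧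
      (D.eta 1 : ℚ) = (v : ℚ) * (r : ℚ) * ((k : ℚ) - (μ : ℚ)) / 2 ∧
      (D.eta r : ℚ) = (v : ℚ) * ((μ : ℚ) - 1) / 2 ∧
      ∀ i : ℕ, 2 ≤ i → i < r → D.eta i = 0) := by
  refine ⟨fun h0 => ?_, fun h => h.1⟩
  have S0 := D.sum_split (fun _ => 1)
  have S1 := D.sum_split (fun i => (i : ℚ))
  have S2 := D.sum_split (fun i => (i : ℚ) ^ 2)
  simp only [D.sum_conc, D.sum_conc_sq μ hint, Finset.sum_const, Finset.card_univ,
    Fintype.card_fin, nsmul_eq_mul] at S0 S1 S2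
  have hr' : (1 : ℚ) < r := by exact_mod_cast hr
  obtain ⟨s, rfl⟩ : ∃ s, r = s + 2 := ⟨r - 2, by omega⟩
  rw [Finset.sum_range_succ, Finset.sum_range_succ', Finset.sum_range_succ'] at S0 S1 S2
  push_cast at S0 S1 S2 h0 ⊢
  have key : ∑ i ∈ Finset.range s, ((i : ℚ) + 1) * (s - i) * D.eta (i + 1 + 1) = 0 := by
    have : ∑ i ∈ Finset.range s, ((i : ℚ) + 1) * (s - i) * D.eta (i + 1 + 1)
      = (s + 3) * ∑ i ∈ Finset.range s, ((i : ℚ) + 1 + 1) * D.eta (i + 1 + 1)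
        - ∑ i ∈ Finset.range s, ((i : ℚ) + 1 + 1) ^ 2 * D.eta (i + 1 + 1)
        - (s + 2) * ∑ i ∈ Finset.range s, 1 * (D.eta (i + 1 + 1) : ℚ) := by
      rw [Finset.mul_sum, Finset.mul_sum, ← Finset.sum_sub_distrib, ← Finset.sum_sub_distrib]
      refine Finset.sum_congr rfl fun i _ => ?_
      ring
    rw [this]
    linear_combination (-(s+3:ℚ)/2) * S1 + S2 / 2 + (s+2:ℚ)/2 * S0 + (s + 2:ℚ) * h0
  have z : ∀ i ∈ Finset.range s, D.eta (i + 1 + 1) = 0 := by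
    intro i hi
    have nn : ∀ i ∈ Finset.range s, 0 ≤ ((i : ℚ) + 1) * (s - i) * D.eta (i + 1 + 1) := by
      intro i hi
      have : (i : ℚ) < s := by exact_mod_cast Finset.mem_range.1 hi
      have : (0 : ℚ) ≤ s - i := by linarith
      positivity
    have h := (Finset.sum_eq_zero_iff_of_nonneg nn).1 key i hi
    have : (i : ℚ) < s := by exact_mod_cast Finset.mem_range.1 hi
    have h3 : (0 : ℚ) < s - i := by linarith
    have h4 : (i : ℚ) + 1 ≠ 0 := by positivity
    simpa [h4, h3.ne'] using h
  have z' : ∀ g : ℕ → ℚ, ∑ i ∈ Finset.range s, g i * (D.eta (i + 1 + 1) : ℚ) = 0 := by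
    intro g
    refine Finset.sum_eq_zero fun i hi => ?_
    rw [z i hi]; simp
  rw [z' (fun i => (i : ℚ) + 1 + 1)] at S1
  rw [z' (fun i => ((i : ℚ) + 1 + 1) ^ 2)] at S2
  have er : (D.eta (s + 2) : ℚ) = v * (μ - 1) / 2 := by
    have hne : ((s : ℚ) + 2) * (s + 1) ≠ 0 := by positivity
    apply mul_left_cancel₀ hne
    linear_combination S1 / 2 - S2 / 2
  refine ⟨h0, ?_, er, ?_⟩
  · linear_combination -S1 / 2 - (s + 2 : ℚ) * er
  · intro i h2 hi
    obtain ⟨t, rfl⟩ : ∃ t, i = t + 1 + 1 := ⟨i - 2, by omega⟩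
    exact z t (by simp; omega)
end

section
/- Let n > 2 and let S be a uniform (n×n)/k semi-Latin square. Then η₀(S) ≥ nk²/2. -/
open Polynomial

theorem SLS_mu {n k : ℕ} (hn : 2 < n) (S : SemiLatinSquare n k) (μ : ℕ)
    (h : S.UniformWith μ) : (k : ℤ) = (n - 1) * μ := by
  let i : Fin n := ⟨0, by omega⟩
  let i' : Fin n := ⟨1, by omega⟩
  have hii : i ≠ i' := by simp [i, i']
  have h1 : (S.block i i).card = ∑ j' : Fin n, (S.block i i ∩ S.block i' j').card := by
    have : S.block i i = Finset.univ.biUnion fun j' => S.block i i ∩ S.block i' j' := by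
      ext x
      simp only [Finset.mem_biUnion, Finset.mem_univ, true_and, Finset.mem_inter]
      constructor
      · intro hx
        obtain ⟨j, hj, _⟩ := S.row_once i' x
        exact ⟨j, hx, hj⟩
      · rintro ⟨j, hx, _⟩
        exact hx
    conv_lhs => rw [this]
    apply Finset.card_biUnion
    intro a _ b _ hab
    rw [Function.onFun, Finset.disjoint_left]
    intro x hx hy
    simp only [Finset.mem_inter] at hx hy
    exact hab ((S.row_once i' x).unique hx.2 hy.2)
  rw [S.blockSize, ← Finset.add_sum_erase _ _ (Finset.mem_univ i)] at h1
  have h0 : (S.block i i ∩ S.block i' i).card = 0 := by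
    rw [Finset.card_eq_zero, Finset.eq_empty_iff_forall_notMem]
    intro x hx
    simp only [Finset.mem_inter] at hx
    exact hii ((S.col_once i x).unique hx.1 hx.2)
  rw [h0, Finset.sum_congr rfl (g := fun _ => μ)] at h1
  · simp only [Finset.sum_const, Finset.card_erase_of_mem (Finset.mem_univ i),
      Finset.card_univ, Fintype.card_fin, smul_eq_mul, zero_add] at h1
    rw [h1]
    push_cast [Nat.cast_sub (show 1 ≤ n by omega)]
    ring
  · intro j hj
    exact h.2 _ _ _ _ hii (Finset.ne_of_mem_erase hj).symm

theorem SLS_local {n k : ℕ} (hn : 2 < n) (S : SemiLatinSquare n k) (μ : ℕ)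
    (h : S.UniformWith μ) (α : Fin (n * k)) :
    k ≤ (Finset.univ.filter fun β => S.concurrence α β = 0).card := by
  have hk := SLS_mu hn S μ h
  choose c hc hcu using fun i => S.row_once i α
  have hinj : ∀ i i', i ≠ i' → c i ≠ c i' := by
    intro i i' hne he
    exact hne ((S.col_once (c i) α).unique (hc i) (by rw [he]; exact hc i'))
  have hlam : ∀ β, S.concurrence α β =
      (Finset.univ.filter fun i => β ∈ S.block i (c i)).card := by
    intro β
    unfold SemiLatinSquare.concurrence
    symm
    apply Finset.card_bij (fun i _ => (i, c i))
    · intro i hi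
      simp only [Finset.mem_filter, Finset.mem_univ, true_and] at hi ⊢
      exact ⟨hc i, hi⟩
    · intro i _ i' _ he
      exact (Prod.ext_iff.1 he).1
    · rintro ⟨i, j⟩ hp
      simp only [Finset.mem_filter, Finset.mem_univ, true_and] at hp
      have := hcu i j hp.1
      subst this
      exact ⟨i, by simpa using hp.2, rfl⟩
  have hle : ∀ β, S.concurrence α β ≤ n := by
    intro β
    rw [hlam]
    exact (Finset.card_le_univ _).trans (by simp)
  have hsum : ∀ β, (S.concurrence α β : ℤ) =
      ∑ i, if β ∈ S.block i (c i) then (1:ℤ) else 0 := by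
    intro β
    rw [hlam]
    simp
  have s1 : ∑ β, (S.concurrence α β : ℤ) = n * k := by
    simp_rw [hsum]
    rw [Finset.sum_comm]
    simp [S.blockSize]
  have s2 : ∑ β, (S.concurrence α β : ℤ) ^ 2 = 2 * n * k := by
    simp_rw [hsum, sq, Finset.sum_mul_sum]
    rw [Finset.sum_comm]
    have : ∀ i : Fin n, ∑ β, ∑ i', (if β ∈ S.block i (c i) then (1:ℤ) else 0) *
        (if β ∈ S.block i' (c i') then (1:ℤ) else 0) = 2 * k := by
      intro i
      rw [Finset.sum_comm]
      have h2 : ∀ i', ∑ β, (if β ∈ S.block i (c i) then (1:ℤ) else 0) *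
        (if β ∈ S.block i' (c i') then (1:ℤ) else 0) =
          ((S.block i (c i) ∩ S.block i' (c i')).card : ℤ) := by
        intro i'
        have h5 : ∀ β, (if β ∈ S.block i (c i) then (1:ℤ) else 0) *
            (if β ∈ S.block i' (c i') then (1:ℤ) else 0) =
            if β ∈ S.block i (c i) ∩ S.block i' (c i') then (1:ℤ) else 0 := by
          intro β
          by_cases h3 : β ∈ S.block i (c i) <;>
            by_cases h4 : β ∈ S.block i' (c i') <;> simp [h3, h4]
        rw [Finset.sum_congr rfl fun β _ => h5 β, Finset.sum_ite_mem]
        simp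
      simp_rw [h2]
      rw [← Finset.add_sum_erase _ _ (Finset.mem_univ i),
        Finset.sum_congr rfl (g := fun _ => (μ : ℤ))]
      · simp only [Finset.sum_const, Finset.card_erase_of_mem (Finset.mem_univ i),
          Finset.card_univ, Fintype.card_fin, nsmul_eq_mul, Finset.inter_self, S.blockSize]
        push_cast [Nat.cast_sub (show 1 ≤ n by omega)]
        linarith
      · intro i' hi'
        have hne := (Finset.ne_of_mem_erase hi').symm
        rw [h.2 _ _ _ _ hne (hinj _ _ hne)]
    simp_rw [this]
    simp
    ring
  have key : ∑ β, ((S.concurrence α β : ℤ) - 1) * ((S.concurrence α β : ℤ) - n) ≤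
      ∑ β, if S.concurrence α β = 0 then (n : ℤ) else 0 := by
    apply Finset.sum_le_sum
    intro β _
    have := hle β
    split_ifs with h0
    · simp [h0]
    · have a1 : (1 : ℤ) ≤ S.concurrence α β := by omega
      have a2 : (S.concurrence α β : ℤ) ≤ n := by omega
      nlinarith
  have e : ∑ β, ((S.concurrence α β : ℤ) - 1) * ((S.concurrence α β : ℤ) - n) = n * k := by
    have : ∀ β, ((S.concurrence α β : ℤ) - 1) * ((S.concurrence α β : ℤ) - n) =
      (S.concurrence α β : ℤ) ^ 2 - (n + 1) * (S.concurrence α β : ℤ) + n := by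
      intro β; ring
    simp_rw [this]
    rw [Finset.sum_add_distrib, Finset.sum_sub_distrib, ← Finset.mul_sum, s1, s2]
    simp
    ring
  rw [e, ← Finset.sum_filter, Finset.sum_const, nsmul_eq_mul] at key
  have hn0 : (0 : ℤ) < n := by omega
  have : (k : ℤ) ≤ ((Finset.univ.filter fun β => S.concurrence α β = 0).card : ℤ) := by
    by_contra hlt
    push Not at hlt
    nlinarith
  exact_mod_cast this

theorem SLS_total {n k : ℕ} (hn : 2 < n) (S : SemiLatinSquare n k) (hS : S.IsUniform) :
    n * k * k ≤ 2 * S.eta 0 := by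
  obtain ⟨μ, h⟩ := hS
  have hsym : ∀ α β, S.concurrence α β = S.concurrence β α := by
    intro α β
    simp only [SemiLatinSquare.concurrence, and_comm]
  have hself : ∀ α, S.concurrence α α ≠ 0 := by
    intro α h0
    obtain ⟨j, hj, _⟩ := S.row_once ⟨0, by omega⟩ α
    simp only [SemiLatinSquare.concurrence, and_self, Finset.card_eq_zero] at h0
    have : ((⟨0, by omega⟩, j) : Fin n × Fin n) ∈ (∅ : Finset (Fin n × Fin n)) := by
      rw [← h0]; simpa using hj
    simp at this
  let A := Finset.univ.filter fun p : Fin (n * k) × Fin (n * k) =>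
    p.1 < p.2 ∧ S.concurrence p.1 p.2 = 0
  let T := Finset.univ.filter fun p : Fin (n * k) × Fin (n * k) => S.concurrence p.1 p.2 = 0
  have hT : n * k * k ≤ T.card := by
    have : T.card = ∑ α, (Finset.univ.filter fun β => S.concurrence α β = 0).card := by
      simp only [T, Finset.card_filter, Fintype.sum_prod_type]
    rw [this]
    calc n * k * k = ∑ α : Fin (n * k), k := by simp
      _ ≤ _ := Finset.sum_le_sum fun α _ => SLS_local hn S μ h α
  have hsub : T ⊆ A ∪ A.image Prod.swap := by
    rintro ⟨a, b⟩ hp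
    simp only [T, A, Finset.mem_filter, Finset.mem_univ, true_and, Finset.mem_union,
      Finset.mem_image, Prod.exists] at hp ⊢
    rcases lt_trichotomy a b with hab | hab | hab
    · exact Or.inl ⟨hab, hp⟩
    · subst hab; exact absurd hp (hself a)
    · exact Or.inr ⟨b, a, ⟨hab, by rw [hsym]; exact hp⟩, rfl⟩
  have hA : A.card = S.eta 0 := rfl
  have := Finset.card_le_card hsub
  have := Finset.card_union_le A (A.image Prod.swap)
  have := Finset.card_image_le (s := A) (f := Prod.swap)
  omega

/-- Theorem 5, inequality: for a uniform `(n×n)/k` semi-Latin square `S` (`n > 2`),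
`η₀(S) ≥ nk²/2`. -/
theorem eta_zero_sls_lower_bound (n k : ℕ) (hn : 2 < n)
    (S : SemiLatinSquare n k) (hS : S.IsUniform) :
    (n : ℚ) * (k : ℚ) ^ 2 / 2 ≤ (S.eta 0 : ℚ) := by
  have h := SLS_total hn S hS
  have h' : (n : ℚ) * k * k ≤ 2 * (S.eta 0 : ℚ) := by exact_mod_cast h
  linarith
end

section
/- Let n > 2, let S be a uniform (n×n)/k semi-Latin square, and let μ = μ(S) = k/(n−1). Then η₀(S) = nk²/2 holds if and only if η₁(S) = n²k(k−μ)/2, η_n(S) = nk(μ−1)/2, and η_i(S) = 0 for all i with 2 ≤ i ≤ n−1; that is (since the replication number of the underlying block design is n), if and only if η(S) = (nk²/2, n²k(k−μ)/2, 0, …, 0, nk(μ−1)/2). -/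
open Polynomial

namespace SLSaux

variable {n k : ℕ}

lemma conc_self (S : SemiLatinSquare n k) (α : Fin (n * k)) : S.concurrence α α = n := by
  unfold SemiLatinSquare.concurrence
  simp only [and_self]
  rw [Finset.card_filter, Fintype.sum_prod_type]
  have : ∀ i : Fin n, (∑ j : Fin n, if α ∈ S.block i j then 1 else 0) = 1 := by
    intro i
    rw [← Finset.card_filter, Finset.card_eq_one]
    obtain ⟨j, hj, hu⟩ := S.row_once i α
    refine ⟨j, ?_⟩
    ext x
    simp only [Finset.mem_filter, Finset.mem_univ, true_and, Finset.mem_singleton]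
    exact ⟨fun h => hu x h, fun h => h ▸ hj⟩
  simp [this]

lemma conc_le (S : SemiLatinSquare n k) (α β : Fin (n * k)) : S.concurrence α β ≤ n := by
  conv_rhs => rw [← conc_self S α]
  unfold SemiLatinSquare.concurrence
  apply Finset.card_le_card
  intro p
  simp only [Finset.mem_filter]
  tauto

lemma conc_comm (S : SemiLatinSquare n k) (α β : Fin (n * k)) :
    S.concurrence α β = S.concurrence β α := by
  unfold SemiLatinSquare.concurrence
  congr 1
  ext p
  simp only [Finset.mem_filter]
  tauto

lemma sum_lt (S : SemiLatinSquare n k) (f : ℕ → ℚ) :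
    (∑ p : Fin (n * k) × Fin (n * k) with p.1 < p.2, f (S.concurrence p.1 p.2))
      = ∑ i ∈ Finset.range (n + 1), (S.eta i : ℚ) * f i := by
  rw [← Finset.sum_fiberwise_of_maps_to (t := Finset.range (n + 1))
    (g := fun p => S.concurrence p.1 p.2)]
  · apply Finset.sum_congr rfl
    intro i _
    rw [Finset.sum_congr rfl (g := fun _ => f i)]
    · rw [Finset.sum_const, nsmul_eq_mul, Finset.filter_filter]
      rfl
    · intro x hx
      rw [(Finset.mem_filter.mp hx).2]
  · intro p _
    simpa [Nat.lt_succ_iff] using conc_le S p.1 p.2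

lemma sum_all (S : SemiLatinSquare n k) (f : ℕ → ℚ) :
    (∑ α, ∑ β, f (S.concurrence α β))
      = (n * k : ℚ) * f n + 2 * ∑ i ∈ Finset.range (n + 1), (S.eta i : ℚ) * f i := by
  rw [← sum_lt]
  have e : ∀ α β : Fin (n * k), f (S.concurrence α β)
      = (if α = β then f n else 0) + ((if α < β then f (S.concurrence α β) else 0)
        + (if β < α then f (S.concurrence β α) else 0)) := by
    intro α β
    rcases lt_trichotomy α β with h | h | h
    · simp [h, h.ne, h.not_gt]
    · subst h; simp [conc_self]
    · simp [h, h.ne', h.not_gt, conc_comm S α β]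
  rw [Finset.sum_congr rfl (fun α _ => Finset.sum_congr rfl (fun β _ => e α β))]
  simp only [Finset.sum_add_distrib]
  rw [Finset.sum_comm (f := fun α β => if β < α then f (S.concurrence β α) else 0)]
  rw [Finset.sum_filter, Fintype.sum_prod_type]
  simp
  ring

lemma conc_eq (S : SemiLatinSquare n k) (α β : Fin (n * k)) :
    (S.concurrence α β : ℚ) = ∑ p : Fin n × Fin n,
      (if α ∈ S.block p.1 p.2 then (1:ℚ) else 0) * (if β ∈ S.block p.1 p.2 then 1 else 0) := by
  unfold SemiLatinSquare.concurrence
  rw [Finset.card_filter]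
  push_cast
  apply Finset.sum_congr rfl
  intro p _
  split_ifs <;> simp_all

lemma moment1 (S : SemiLatinSquare n k) :
    (∑ α, ∑ β, (S.concurrence α β : ℚ)) = n ^ 2 * k ^ 2 := by
  simp only [conc_eq]
  have : ∀ p : Fin n × Fin n, ∑ α, (if α ∈ S.block p.1 p.2 then (1:ℚ) else 0) = k := by
    intro p; simp [S.blockSize]
  rw [Finset.sum_congr rfl (fun α _ => Finset.sum_comm)]
  rw [Finset.sum_comm]
  simp only [← Finset.mul_sum, ← Finset.sum_mul, this]
  simp
  ring

lemma inter_card (S : SemiLatinSquare n k) {μ : ℕ} (hS : S.UniformWith μ) (p q : Fin n × Fin n) :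
    ((S.block p.1 p.2 ∩ S.block q.1 q.2).card : ℚ) ^ 2 =
     (if q.1 = p.1 then (1:ℚ) else 0) * (if q.2 = p.2 then 1 else 0) * k ^ 2
      + (1 - if q.1 = p.1 then (1:ℚ) else 0) * (1 - if q.2 = p.2 then 1 else 0) * μ ^ 2 := by
  obtain ⟨i, j⟩ := p
  obtain ⟨i', j'⟩ := q
  by_cases h1 : i' = i <;> by_cases h2 : j' = j
  · subst h1 h2; simp [S.blockSize]
  · subst h1
    have : S.block i' j ∩ S.block i' j' = ∅ := by
      ext x
      simp only [Finset.mem_inter, Finset.notMem_empty, iff_false]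
      rintro ⟨a, b⟩
      exact h2 ((S.row_once i' x).unique b a)
    simp [h2, this]
  · subst h2
    have : S.block i j' ∩ S.block i' j' = ∅ := by
      ext x
      simp only [Finset.mem_inter, Finset.notMem_empty, iff_false]
      rintro ⟨a, b⟩
      exact h1 ((S.col_once j' x).unique b a)
    simp [h1, this]
  · simp [h1, h2, hS.2 i j i' j' (Ne.symm h1) (Ne.symm h2)]

lemma moment2 (S : SemiLatinSquare n k) {μ : ℕ} (hS : S.UniformWith μ) :
    (∑ α, ∑ β, (S.concurrence α β : ℚ) ^ 2)
      = n ^ 2 * (k ^ 2 + (n - 1) ^ 2 * μ ^ 2) := by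
  have h1 : ∀ p q : Fin n × Fin n, ((S.block p.1 p.2 ∩ S.block q.1 q.2).card : ℚ)
     = ∑ α, (if α ∈ S.block p.1 p.2 then (1:ℚ) else 0)
        * (if α ∈ S.block q.1 q.2 then (1:ℚ) else 0) := by
    intro p q
    have e : ∀ α, (if α ∈ S.block p.1 p.2 then (1:ℚ) else 0)
        * (if α ∈ S.block q.1 q.2 then (1:ℚ) else 0)
        = if α ∈ S.block p.1 p.2 ∩ S.block q.1 q.2 then 1 else 0 := by
      intro α
      simp only [Finset.mem_inter]
      split_ifs <;> simp_all
    simp only [e]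
    rw [Finset.sum_boole, Finset.filter_mem_eq_inter, Finset.univ_inter]
  have h2 : (∑ α, ∑ β, (S.concurrence α β : ℚ) ^ 2) = ∑ p : Fin n × Fin n, ∑ q : Fin n × Fin n,
      ((S.block p.1 p.2 ∩ S.block q.1 q.2).card : ℚ) ^ 2 := by
    simp only [conc_eq, h1, sq, Finset.sum_mul_sum]
    rw [Finset.sum_congr rfl (fun α _ => Finset.sum_comm)]
    rw [Finset.sum_comm]
    apply Finset.sum_congr rfl
    intro p _
    rw [Finset.sum_congr rfl (fun α _ => Finset.sum_comm)]
    rw [Finset.sum_comm]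
    apply Finset.sum_congr rfl
    intro q _
    apply Finset.sum_congr rfl
    intro α _
    apply Finset.sum_congr rfl
    intro β _
    ring
  rw [h2]
  simp only [inter_card S hS]
  have h3 : ∀ p : Fin n × Fin n, (∑ q : Fin n × Fin n,
     ((if q.1 = p.1 then (1:ℚ) else 0) * (if q.2 = p.2 then (1:ℚ) else 0) * (k:ℚ) ^ 2
      + (1 - if q.1 = p.1 then (1:ℚ) else 0) * (1 - if q.2 = p.2 then (1:ℚ) else 0) * (μ:ℚ) ^ 2))
      = (k:ℚ) ^ 2 + ((n:ℚ) - 1) ^ 2 * (μ:ℚ) ^ 2 := by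
    intro p
    have A : ∀ c : Fin n, (∑ x : Fin n, if x = c then (1:ℚ) else 0) = 1 := by
      intro c; simp
    have B : ∀ c : Fin n, (∑ x : Fin n, (1 - if x = c then (1:ℚ) else 0)) = (n:ℚ) - 1 := by
      intro c; rw [Finset.sum_sub_distrib, A]; simp
    have C := Finset.sum_mul_sum (Finset.univ : Finset (Fin n)) (Finset.univ : Finset (Fin n))
      (fun x => if x = p.1 then (1:ℚ) else 0) (fun x => if x = p.2 then (1:ℚ) else 0)
    have D := Finset.sum_mul_sum (Finset.univ : Finset (Fin n)) (Finset.univ : Finset (Fin n))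
      (fun x => 1 - if x = p.1 then (1:ℚ) else 0) (fun x => 1 - if x = p.2 then (1:ℚ) else 0)
    rw [A, A] at C
    rw [B, B] at D
    rw [Fintype.sum_prod_type]
    simp only [Finset.sum_add_distrib, ← Finset.sum_mul]
    refine (congrArg₂ (fun a b : ℚ => a * (k:ℚ) ^ 2 + b * (μ:ℚ) ^ 2) C.symm D.symm).trans ?_
    ring
  simp only [h3]
  simp
  ring

end SLSaux

/-- Theorem 5, equivalence of conditions 1 and 2: for a uniform `(n×n)/k` semi-Latin
square `S` (`n > 2`) with `μ = μ(S) = k/(n−1)`, `η₀(S) = nk²/2` holds iff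
`η(S) = (nk²/2, n²k(k−μ)/2, 0, …, 0, nk(μ−1)/2)` (the replication number is `n`). -/
theorem eta_zero_sls_equality_iff_eta_vector (n k μ : ℕ) (hn : 2 < n) (hμ : 0 < μ)
    (hk : k = μ * (n - 1)) (S : SemiLatinSquare n k) (hS : S.UniformWith μ) :
    (S.eta 0 : ℚ) = (n : ℚ) * (k : ℚ) ^ 2 / 2
      ↔
    ((S.eta 0 : ℚ) = (n : ℚ) * (k : ℚ) ^ 2 / 2 ∧
      (S.eta 1 : ℚ) = (n : ℚ) ^ 2 * (k : ℚ) * ((k : ℚ) - (μ : ℚ)) / 2 ∧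
      (S.eta n : ℚ) = (n : ℚ) * (k : ℚ) * ((μ : ℚ) - 1) / 2 ∧
      ∀ i : ℕ, 2 ≤ i → i < n → S.eta i = 0) := by
  refine ⟨fun h0 => ?_, fun h => h.1⟩
  have hn1 : (2:ℚ) < n := by exact_mod_cast hn
  have hkq : (k : ℚ) = μ * ((n : ℚ) - 1) := by
    rw [hk]; push_cast [Nat.cast_sub (show 1 ≤ n by omega)]; ring
  have hkpos : (0:ℚ) < k := by
    have : (0:ℚ) < μ := by exact_mod_cast hμ
    rw [hkq]; exact mul_pos this (by linarith)
  have m1 := SLSaux.moment1 S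
  have m2 := SLSaux.moment2 S hS
  have m0 : (∑ α : Fin (n * k), ∑ β : Fin (n * k), (1:ℚ)) = n ^ 2 * k ^ 2 := by
    simp; ring
  have m2' : (∑ α, ∑ β, (S.concurrence α β : ℚ) ^ 2) = 2 * (n ^ 2 * k ^ 2) := by
    rw [m2, hkq]; ring
  have gen : ∀ a b c : ℚ, (∑ α, ∑ β, (a * (S.concurrence α β : ℚ) ^ 2
      + b * (S.concurrence α β : ℚ) + c * 1)) = (2 * a + b + c) * (n ^ 2 * k ^ 2) := by
    intro a b c
    simp only [Finset.sum_add_distrib, ← Finset.mul_sum]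
    rw [m0, m1, m2']; ring
  have key : ∀ a b c : ℚ, (2 * a + b + c) * (n ^ 2 * k ^ 2) =
      (n * k : ℚ) * (a * (n:ℚ) ^ 2 + b * n + c * 1) +
      2 * ∑ i ∈ Finset.range (n + 1), (S.eta i : ℚ) * (a * (i:ℚ) ^ 2 + b * i + c * 1) := by
    intro a b c
    rw [← gen a b c]
    exact SLSaux.sum_all S (fun i => a * (i:ℚ) ^ 2 + b * i + c * 1)
  have hz : ∀ i : ℕ, 2 ≤ i → i < n → S.eta i = 0 := by
    have k1 := key (-1) (n + 1) (-n)
    rw [Finset.sum_range_succ', h0] at k1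
    have k2 : ∑ i ∈ Finset.range n, (S.eta (i + 1) : ℚ) *
        (-1 * ((i + 1 : ℕ):ℚ) ^ 2 + (n + 1) * ((i + 1 : ℕ):ℚ) + -n * 1) = 0 := by
      push_cast at k1 ⊢
      linarith
    have hf : ∀ i : ℕ, (-1 * ((i + 1 : ℕ):ℚ) ^ 2 + (n + 1) * ((i + 1 : ℕ):ℚ) + -n * 1)
        = i * ((n:ℚ) - 1 - i) := by
      intro i; push_cast; ring
    simp only [hf] at k2
    rw [Finset.sum_eq_zero_iff_of_nonneg] at k2
    · intro i hi hin
      have := k2 (i - 1) (Finset.mem_range.mpr (by omega))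
      rw [show i - 1 + 1 = i by omega, Nat.cast_sub (by omega : 1 ≤ i)] at this
      have a1 : (2:ℚ) ≤ i := by exact_mod_cast hi
      have a2 : (i:ℚ) < n := by exact_mod_cast hin
      push_cast at this
      rcases mul_eq_zero.mp this with h | h
      · exact_mod_cast h
      · rcases mul_eq_zero.mp h with h | h <;> linarith
    · intro i hi
      have : ((i + 1 : ℕ) : ℚ) ≤ n := by exact_mod_cast Finset.mem_range.mp hi
      push_cast at this
      exact mul_nonneg (Nat.cast_nonneg _) (mul_nonneg (Nat.cast_nonneg _) (by linarith))
  refine ⟨h0, ?_, ?_, hz⟩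
  · have k1 := key (-1) n 0
    rw [Finset.sum_eq_single 1] at k1
    · have hne : (n:ℚ) - 1 ≠ 0 := by linarith
      apply mul_left_cancel₀ hne
      push_cast at k1
      rw [hkq] at k1 ⊢
      linarith
    · intro i hi h1
      have hi' := Finset.mem_range.mp hi
      rcases Nat.eq_zero_or_pos i with h | h
      · subst h; simp
      · rcases Nat.lt_or_ge i n with h' | h'
        · rw [hz i (by omega) h']; simp
        · have : i = n := by omega
          subst this; ring
    · intro h; exact absurd (Finset.mem_range.mpr (by omega)) h
  · have k1 := key 1 (-1) 0
    rw [Finset.sum_eq_single n] at k1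
    · have hne : (n:ℚ) * ((n:ℚ) - 1) ≠ 0 := mul_ne_zero (by linarith) (by linarith)
      apply mul_left_cancel₀ hne
      rw [hkq] at k1 ⊢
      linarith
    · intro i hi h1
      have hi' := Finset.mem_range.mp hi
      rcases Nat.lt_or_ge i 2 with h | h
      · interval_cases i <;> simp
      · rw [hz i h (by omega)]; simp
    · intro h; exact absurd (Finset.mem_range.mpr (by omega)) h
end

section
/- Let n > 2, let S be a uniform (n×n)/k semi-Latin square, and let μ = k/(n−1). Then η₀(S) = nk²/2 holds if and only if S is a μ-fold inflation of a superposition of n−1 mutually orthogonal Latin squares of order n (with pairwise disjoint symbol sets). -/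
open Polynomial

namespace SLSAux
open Finset

variable {n k : ℕ} (S : SemiLatinSquare n k)

noncomputable def col (α : Fin (n * k)) (i : Fin n) : Fin n := (S.row_once i α).choose

lemma mem_iff (α : Fin (n * k)) (i j : Fin n) : α ∈ S.block i j ↔ col S α i = j := by
  have h := (S.row_once i α).choose_spec
  constructor
  · intro hj
    exact (h.2 j hj).symm
  · rintro rfl
    exact h.1

lemma col_inj (α : Fin (n * k)) : Function.Injective (col S α) := by
  intro i i' h
  exact (S.col_once (col S α i') α).unique ((mem_iff S _ _ _).2 h) ((mem_iff S _ _ _).2 rfl)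

lemma conc_eq (α β : Fin (n * k)) :
    S.concurrence α β = (univ.filter fun i => col S α i = col S β i).card := by
  unfold SemiLatinSquare.concurrence
  symm
  apply Finset.card_bij (fun i _ => (i, col S α i))
  · intro i hi
    simp only [mem_filter, mem_univ, true_and, mem_iff] at hi ⊢
    exact hi.symm
  · intro a _ b _ h
    exact (Prod.ext_iff.1 h).1
  · rintro ⟨i, j⟩ h
    simp only [mem_filter, mem_univ, true_and, mem_iff] at h
    refine ⟨i, ?_, ?_⟩
    · simp [h.1, h.2]
    · simp [h.1]

lemma conc_comm (α β : Fin (n * k)) : S.concurrence α β = S.concurrence β α := by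
  simp only [SemiLatinSquare.concurrence, and_comm]

lemma conc_self (α : Fin (n * k)) : S.concurrence α α = n := by
  simp [conc_eq]

lemma conc_le (α β : Fin (n * k)) : S.concurrence α β ≤ n := by
  rw [conc_eq]
  exact (card_le_univ _).trans (by simp)

lemma conc_eq_n {α β : Fin (n * k)} : S.concurrence α β = n ↔ ∀ i, col S α i = col S β i := by
  rw [conc_eq]
  constructor
  · intro h i
    have : (univ.filter fun i => col S α i = col S β i) = univ := by
      rw [← card_eq_iff_eq_univ]; simpa using h
    have h2 := mem_univ i
    rw [← this] at h2
    simpa using h2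
  · intro h
    simp [h]

lemma conc_pos {α β : Fin (n * k)} {i : Fin n} (h : col S α i = col S β i) :
    S.concurrence α β ≠ 0 := by
  rw [conc_eq]
  exact (card_pos.2 ⟨i, by simpa using h⟩).ne'

lemma block_eq (i j : Fin n) : S.block i j = univ.filter fun β => col S β i = j := by
  ext β; simp [mem_iff]

lemma block_card (i j : Fin n) : (univ.filter fun β => col S β i = j).card = k := by
  rw [← block_eq]; exact S.blockSize i j

lemma inter_term {μ : ℕ} (hU : S.UniformWith μ) (α : Fin (n * k)) (i j i' : Fin n) :
    (univ.filter fun β => col S β i = j ∧ col S α i' = col S β i').card =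
      if i' = i then (if col S α i = j then k else 0) else
        if col S α i' = j then 0 else μ := by
  split_ifs with h1 h2 h3
  · subst h1; subst h2
    refine Eq.trans ?_ (block_card S i' (col S α i'))
    congr 1; ext β; simp [eq_comm]
  · subst h1
    rw [card_eq_zero, filter_eq_empty_iff]
    rintro β - ⟨h, h'⟩
    exact h2 (h'.trans h)
  · rw [card_eq_zero, filter_eq_empty_iff]
    rintro β - ⟨h, h'⟩
    apply h1
    apply col_inj S β
    rw [← h', h3, h]
  · rw [← hU.2 i j i' (col S α i') (Ne.symm h1) (Ne.symm h3)]
    congr 1; ext β; simp [mem_iff, eq_comm]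

lemma k_eq {μ : ℕ} (hn : 2 < n) (hU : S.UniformWith μ) : k = μ * (n - 1) := by
  let i0 : Fin n := ⟨0, by omega⟩
  let i1 : Fin n := ⟨1, by omega⟩
  have h01 : i0 ≠ i1 := by simp [i0, i1]
  have h1 : ∑ j, (S.block i0 i0 ∩ S.block i1 j).card = k := by
    have := Finset.card_eq_sum_card_fiberwise (s := S.block i0 i0) (t := univ)
      (f := fun β => col S β i1) (fun _ _ => by simp)
    rw [S.blockSize] at this
    refine Eq.trans ?_ this.symm
    apply sum_congr rfl
    intro j _
    congr 1; ext β; simp [mem_iff]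
  have h2 : ∀ j, (S.block i0 i0 ∩ S.block i1 j).card = if j = i0 then 0 else μ := by
    intro j
    split_ifs with h
    · subst h
      rw [card_eq_zero, eq_empty_iff_forall_notMem]
      intro β hβ
      rw [mem_inter, mem_iff, mem_iff] at hβ
      exact h01 (col_inj S β (hβ.1.trans hβ.2.symm))
    · exact hU.2 _ _ _ _ h01 (Ne.symm h)
  simp only [h2] at h1
  rw [← h1, Finset.sum_ite]
  simp [Finset.filter_ne', mul_comm]

lemma loc_sum {μ : ℕ} (hn : 2 < n) (hU : S.UniformWith μ) (α : Fin (n * k)) (i j : Fin n) :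
    ∑ β with col S β i = j, S.concurrence α β =
      if col S α i = j then 2 * k else (n - 2) * μ := by
  have h1 : ∑ β with col S β i = j, S.concurrence α β =
      ∑ i', (univ.filter fun β => col S β i = j ∧ col S α i' = col S β i').card := by
    simp only [conc_eq, card_filter, ite_and, sum_filter]
    rw [sum_comm]
    apply sum_congr rfl; intro β _
    split_ifs <;> simp
  rw [h1]
  simp only [inter_term S hU]
  have hk := k_eq S hn hU
  split_ifs with h
  · have : ∀ i', (if i' = i then k else if col S α i' = j then 0 else μ) =
        if i' = i then k else μ := by
      intro i'
      split_ifs with h1 h2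
      · rfl
      · exact absurd (col_inj S α (h2.trans h.symm)) h1
      · rfl
    simp only [this]
    rw [Finset.sum_ite]
    simp [Finset.filter_eq', Finset.filter_ne']
    rw [two_mul, mul_comm, ← hk]
  · obtain ⟨i2, hi2⟩ := (Finite.injective_iff_surjective.1 (col_inj S α)) j
    have hne : i2 ≠ i := by rintro rfl; exact h hi2
    have : ∀ i', (if i' = i then 0 else if col S α i' = j then 0 else μ) =
        if i' ∈ ({i, i2} : Finset (Fin n))ᶜ then μ else 0 := by
      intro i'
      have : col S α i' = j ↔ i' = i2 := by
        rw [← hi2]; exact (col_inj S α).eq_iff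
      simp only [this, mem_compl, mem_insert, mem_singleton]
      split_ifs <;> tauto
    simp only [this]
    rw [← Finset.sum_filter, Finset.filter_mem_eq_inter, univ_inter, sum_const, card_compl,
      card_pair hne.symm, Fintype.card_fin, smul_eq_mul]

lemma sum_one {μ : ℕ} (α : Fin (n * k)) : ∑ β, S.concurrence α β = n * k := by
  simp only [conc_eq, card_filter]
  rw [sum_comm]
  simp only [← card_filter]
  have : ∀ i, (univ.filter fun β => col S α i = col S β i).card = k := by
    intro i
    refine Eq.trans ?_ (block_card S i (col S α i))
    congr 1; ext β; simp [eq_comm]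
  simp [this]

lemma sum_sq {μ : ℕ} (hn : 2 < n) (hU : S.UniformWith μ) (α : Fin (n * k)) :
    ∑ β, S.concurrence α β ^ 2 = n * (2 * k) := by
  have h : ∀ β, S.concurrence α β ^ 2 =
      ∑ i, if col S β i = col S α i then S.concurrence α β else 0 := by
    intro β
    rw [← sum_filter, sum_const, smul_eq_mul, sq]
    congr 1
    rw [conc_comm, conc_eq]
  simp only [h]
  rw [sum_comm]
  simp only [← sum_filter, loc_sum S hn hU]
  simp

lemma sum_poly {μ : ℕ} (hn : 2 < n) (hU : S.UniformWith μ) (α : Fin (n * k)) :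
    ∑ β, ((S.concurrence α β : ℤ) - 1) * ((S.concurrence α β : ℤ) - n) = n * k := by
  have h1 : ∑ β, (S.concurrence α β : ℤ) = n * k := by exact_mod_cast sum_one S (μ := μ) α
  have h2 : ∑ β, (S.concurrence α β : ℤ) ^ 2 = n * (2 * k) := by
    exact_mod_cast sum_sq S hn hU α
  have : ∀ β, ((S.concurrence α β : ℤ) - 1) * ((S.concurrence α β : ℤ) - n) =
      (S.concurrence α β : ℤ) ^ 2 - (n + 1) * S.concurrence α β + n := by intro β; ring
  simp only [this, sum_add_distrib, sum_sub_distrib, ← mul_sum, h1, h2]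
  simp
  ring

lemma two_eta (hn : 2 < n) :
    2 * S.eta 0 = (univ.filter fun p : Fin (n * k) × Fin (n * k) =>
      S.concurrence p.1 p.2 = 0).card := by
  have h1 : (univ.filter fun p : Fin (n * k) × Fin (n * k) => S.concurrence p.1 p.2 = 0) =
      (univ.filter fun p : Fin (n * k) × Fin (n * k) =>
        p.1 < p.2 ∧ S.concurrence p.1 p.2 = 0) ∪
      (univ.filter fun p : Fin (n * k) × Fin (n * k) =>
        p.2 < p.1 ∧ S.concurrence p.1 p.2 = 0) := by
    ext ⟨a, b⟩
    simp only [mem_union, mem_filter, mem_univ, true_and]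
    constructor
    · intro h
      rcases lt_trichotomy a b with h' | h' | h'
      · exact Or.inl ⟨h', h⟩
      · subst h'; rw [conc_self] at h; omega
      · exact Or.inr ⟨h', h⟩
    · tauto
  rw [h1, card_union_of_disjoint]
  · rw [two_mul]
    congr 1
    unfold SemiLatinSquare.eta
    apply Finset.card_bij (fun p _ => (p.2, p.1))
    · intro p hp
      simp only [mem_filter, mem_univ, true_and] at hp ⊢
      rw [conc_comm]; exact hp
    · rintro ⟨a, b⟩ _ ⟨c, d⟩ _ h
      simp only [Prod.mk.injEq] at h ⊢
      exact ⟨h.2, h.1⟩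
    · rintro ⟨a, b⟩ h
      refine ⟨(b, a), ?_, rfl⟩
      simp only [mem_filter, mem_univ, true_and] at h ⊢
      rw [conc_comm]; exact h
  · rw [disjoint_filter]
    rintro p - h h'
    exact absurd h.1 (lt_asymm h'.1)

lemma eta_iff {μ : ℕ} (hn : 2 < n) (hU : S.UniformWith μ) :
    (S.eta 0 : ℚ) = (n : ℚ) * (k : ℚ) ^ 2 / 2 ↔
      ∀ α β, S.concurrence α β = 0 ∨ S.concurrence α β = 1 ∨ S.concurrence α β = n := by
  let g : Fin (n * k) × Fin (n * k) → ℤ := fun p =>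
    if S.concurrence p.1 p.2 = 0 then 0 else
      -(((S.concurrence p.1 p.2 : ℤ) - 1) * ((S.concurrence p.1 p.2 : ℤ) - n))
  have hg : ∀ p, 0 ≤ g p := by
    intro p
    simp only [g]
    split_ifs with h
    · exact le_rfl
    · have h1 : (1 : ℤ) ≤ S.concurrence p.1 p.2 := by
        exact_mod_cast Nat.one_le_iff_ne_zero.2 h
      have h2 : (S.concurrence p.1 p.2 : ℤ) ≤ n := by exact_mod_cast conc_le S p.1 p.2
      nlinarith
  have hg0 : ∀ p, g p = 0 ↔ S.concurrence p.1 p.2 = 0 ∨ S.concurrence p.1 p.2 = 1 ∨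
      S.concurrence p.1 p.2 = n := by
    intro p
    simp only [g]
    split_ifs with h
    · simp [h]
    · rw [neg_eq_zero, mul_eq_zero, sub_eq_zero, sub_eq_zero]
      norm_cast
      tauto
  have hsum : (n : ℤ) * (2 * S.eta 0) - ∑ p, g p = n * k * (n * k) := by
    have h1 : ∑ p : Fin (n * k) × Fin (n * k), ((S.concurrence p.1 p.2 : ℤ) - 1) *
        ((S.concurrence p.1 p.2 : ℤ) - n) = n * k * (n * k) := by
      rw [Fintype.sum_prod_type]
      simp only [sum_poly S hn hU]
      simp
    have h2 : ∀ p : Fin (n * k) × Fin (n * k), ((S.concurrence p.1 p.2 : ℤ) - 1) *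
        ((S.concurrence p.1 p.2 : ℤ) - n) =
        n * (if S.concurrence p.1 p.2 = 0 then 1 else 0) - g p := by
      intro p
      simp only [g]
      split_ifs with h
      · simp [h]
      · ring
    rw [← h1]
    simp only [h2]
    rw [sum_sub_distrib, ← mul_sum]
    congr 2
    have := two_eta S hn
    rw [card_filter] at this
    exact_mod_cast this
  have hn0 : (n : ℤ) ≠ 0 := by positivity
  have e1 : (S.eta 0 : ℚ) = (n : ℚ) * (k : ℚ) ^ 2 / 2 ↔ (2 * S.eta 0 : ℤ) = n * k ^ 2 := by
    rw [eq_div_iff (by norm_num)]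
    rw [mul_comm]
    norm_cast
  have e2 : (2 * S.eta 0 : ℤ) = n * k ^ 2 ↔ ∑ p, g p = 0 := by
    rw [← mul_right_inj' hn0]
    constructor
    · intro h; linarith
    · intro h; linarith
  rw [e1, e2, sum_eq_zero_iff_of_nonneg (fun p _ => hg p)]
  simp only [mem_univ, true_imp_iff, hg0, Prod.forall]

lemma loc_count {μ : ℕ} (hn : 2 < n) (hU : S.UniformWith μ)
    (hl : ∀ α β, S.concurrence α β = 0 ∨ S.concurrence α β = 1 ∨ S.concurrence α β = n)
    (α : Fin (n * k)) (i j : Fin n) :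
    (univ.filter fun β => col S β i = j ∧ S.concurrence α β ≠ 1).card = μ := by
  have hs := loc_sum S hn hU α i j
  have hc := block_card S i j
  have hk := k_eq S hn hU
  have hsplit : (univ.filter fun β => col S β i = j ∧ S.concurrence α β ≠ 1).card +
    (univ.filter fun β => col S β i = j ∧ S.concurrence α β = 1).card = k := by
    refine Eq.trans ?_ hc
    rw [← Finset.card_filter_add_card_filter_not (s := univ.filter fun β => col S β i = j)
      (p := fun β => S.concurrence α β ≠ 1)]
    simp only [filter_filter, not_not]
  obtain ⟨m, rfl⟩ : ∃ m, n = m + 2 := ⟨n - 2, by omega⟩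
  have key : ∀ c, (∀ β, col S β i = j → S.concurrence α β ≠ 1 → S.concurrence α β = c) →
      ∑ β with col S β i = j, S.concurrence α β =
      c * (univ.filter fun β => col S β i = j ∧ S.concurrence α β ≠ 1).card +
      (univ.filter fun β => col S β i = j ∧ S.concurrence α β = 1).card := by
    intro c hcc
    simp only [card_filter, mul_sum, sum_filter]
    rw [← sum_add_distrib]
    apply sum_congr rfl
    intro β _
    by_cases h1 : col S β i = j
    · by_cases h2 : S.concurrence α β = 1
      · simp [h1, h2]
      · have h3 := hcc β h1 h2
        have h4 : c ≠ 1 := h3 ▸ h2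
        simp [h1, h3, h4]
    · simp [h1]
  split_ifs at hs with h
  · rw [key (m + 2)] at hs
    · have h3 : m + 2 - 1 = m + 1 := rfl
      rw [h3] at hk
      have : (m + 1) * (univ.filter fun β => col S β i = j ∧ S.concurrence α β ≠ 1).card
        = (m + 1) * μ := by linarith
      exact Nat.eq_of_mul_eq_mul_left (by omega) this
    · intro β h1 h2
      have := conc_pos S (h.trans h1.symm)
      have := hl α β
      tauto
  · rw [key 0] at hs
    · have h3 : m + 2 - 1 = m + 1 := rfl
      have h4 : m + 2 - 2 = m := rfl
      rw [h3] at hk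
      rw [h4] at hs
      linarith
    · intro β h1 h2
      have := hl α β
      rcases this with h3 | h3 | h3
      · exact h3
      · exact absurd h3 h2
      · rw [conc_eq_n] at h3
        exact absurd ((h3 i).trans h1) h

lemma trans_par {μ : ℕ} (hn : 2 < n) (hU : S.UniformWith μ)
    (hl : ∀ α β, S.concurrence α β = 0 ∨ S.concurrence α β = 1 ∨ S.concurrence α β = n)
    {α β γ : Fin (n * k)} (h1 : S.concurrence α β ≠ 1) (h2 : S.concurrence β γ ≠ 1) :
    S.concurrence α γ ≠ 1 := by
  intro h
  have h0 : 0 < S.concurrence α γ := by omega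
  rw [conc_eq, card_pos] at h0
  obtain ⟨i, hi⟩ := h0
  simp only [mem_filter, mem_univ, true_and] at hi
  -- the parallels to α at the cell of α are exactly the parallels to β there
  have hA := loc_count S hn hU hl α i (col S α i)
  have hB := loc_count S hn hU hl β i (col S α i)
  have hsub : (univ.filter fun δ => col S δ i = col S α i ∧ S.concurrence α δ ≠ 1) ⊆
      (univ.filter fun δ => col S δ i = col S α i ∧ S.concurrence β δ ≠ 1) := by
    intro δ hδ
    simp only [mem_filter, mem_univ, true_and] at hδ ⊢
    refine ⟨hδ.1, ?_⟩
    have h3 := conc_pos S hδ.1.symm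
    have h4 : S.concurrence α δ = n := by have := hl α δ; tauto
    rw [conc_eq_n] at h4
    have : S.concurrence β δ = S.concurrence α β := by
      rw [conc_comm S α β, conc_eq, conc_eq]
      simp only [h4]
    rw [this]; exact h1
  have heq := eq_of_subset_of_card_le hsub (by rw [hA, hB])
  have : γ ∈ (univ.filter fun δ => col S δ i = col S α i ∧ S.concurrence β δ ≠ 1) := by
    simp [hi, h2]
  rw [← heq] at this
  simp [h] at this

lemma forward {μ : ℕ} (hn : 2 < n) (hU : S.UniformWith μ)
    (hl : ∀ α β, S.concurrence α β = 0 ∨ S.concurrence α β = 1 ∨ S.concurrence α β = n) :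
    S.IsInflatedMOLSSuperposition μ := by
  classical
  let s : Setoid (Fin (n * k)) :=
    { r := fun α β => S.concurrence α β ≠ 1
      iseqv := ⟨fun α => by rw [conc_self]; omega,
        fun {a b} h => by rw [conc_comm]; exact h,
        fun h h' => trans_par S hn hU hl h h'⟩ }
  have hμ := hU.1
  let i0 : Fin n := ⟨0, by omega⟩
  have hcnt : ∀ (t : Quotient s) (i j : Fin n),
      (univ.filter fun β => col S β i = j ∧ (Quotient.mk s β) = t).card = μ := by
    intro t i j
    induction t using Quotient.inductionOn with
    | h α =>
      rw [← loc_count S hn hU hl α i j]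
      congr 1; ext β
      simp only [mem_filter, mem_univ, true_and]
      rw [Quotient.eq, conc_comm]
      rfl
  have hcardQ : Fintype.card (Quotient s) = n - 1 := by
    have h1 := Finset.card_eq_sum_card_fiberwise (s := univ.filter fun β => col S β i0 = i0)
      (t := univ) (f := fun β => Quotient.mk s β) (fun _ _ => by simp)
    simp only [filter_filter, hcnt] at h1
    rw [block_card] at h1
    simp only [sum_const, card_univ, smul_eq_mul] at h1
    have hk := k_eq S hn hU
    have : μ * Fintype.card (Quotient s) = μ * (n - 1) := by linarith
    exact Nat.eq_of_mul_eq_mul_left hμ this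
  let q : Quotient s ≃ Fin (n - 1) := Fintype.equivFinOfCardEq hcardQ
  have hex : ∀ (t : Quotient s) (i j : Fin n), ∃ β, col S β i = j ∧ Quotient.mk s β = t := by
    intro t i j
    have : 0 < (univ.filter fun β => col S β i = j ∧ (Quotient.mk s β) = t).card := by
      rw [hcnt]; exact hμ
    obtain ⟨β, hβ⟩ := card_pos.1 this
    exact ⟨β, by simpa using hβ⟩
  choose b hb1 hb2 using hex
  have hsame : ∀ α β i, Quotient.mk s α = Quotient.mk s β → col S α i = col S β i →
      ∀ i', col S α i' = col S β i' := by
    intro α β i h1 h2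
    have h3 : S.concurrence α β ≠ 1 := Quotient.exact h1
    have h4 := conc_pos S h2
    rw [← conc_eq_n]
    have := hl α β
    tauto
  let L : Fin (n - 1) → Fin n → Fin n → Fin n := fun t i j => col S (b (q.symm t) i j) i0
  let f : Fin (n * k) → Fin (n - 1) × Fin n := fun α => (q (Quotient.mk s α), col S α i0)
  have hL : ∀ α i j, α ∈ S.block i j ↔ L (f α).1 i j = (f α).2 := by
    intro α i j
    rw [mem_iff]
    simp only [L, f, Equiv.symm_apply_apply]
    constructor
    · intro h
      exact hsame _ _ i (hb2 _ i j) ((hb1 _ i j).trans h.symm) i0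
    · intro h
      rw [← hsame _ _ i0 (hb2 _ i j) h i]
      exact hb1 _ i j
  have hf : ∀ x, Fintype.card {α // f α = x} = μ := by
    rintro ⟨t, c⟩
    rw [Fintype.card_subtype, ← hcnt (q.symm t) i0 c]
    congr 1; ext α
    simp only [mem_filter, mem_univ, true_and, f, Prod.mk.injEq, ← Equiv.apply_eq_iff_eq_symm_apply]
    tauto
  have hfs : ∀ x, ∃ α, f α = x := by
    intro x
    have : 0 < Fintype.card {α // f α = x} := by rw [hf]; exact hμ
    obtain ⟨α⟩ := Fintype.card_pos_iff.1 this
    exact ⟨α.1, α.2⟩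
  let e : Fin (n * k) ≃ (Fin (n - 1) × Fin n) × Fin μ :=
    ((Equiv.sigmaFiberEquiv f).symm.trans
      (Equiv.sigmaCongrRight fun x => Fintype.equivFinOfCardEq (hf x))).trans
      (Equiv.sigmaEquivProd _ _)
  have he : ∀ α, (e α).1 = f α := fun α => rfl
  refine ⟨L, ⟨?_, ?_⟩, e, ?_⟩
  · intro t
    constructor
    · intro i a
      obtain ⟨α, hα⟩ := hfs (t, a)
      have := S.row_once i α
      simpa only [hL, hα] using this
    · intro j a
      obtain ⟨α, hα⟩ := hfs (t, a)
      have := S.col_once j α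
      simpa only [hL, hα] using this
  · intro t t' htt a c
    obtain ⟨α, hα⟩ := hfs (t, a)
    obtain ⟨β, hβ⟩ := hfs (t', c)
    have h1 : S.concurrence α β = 1 := by
      by_contra h
      apply htt
      have h2 : Quotient.mk s α = Quotient.mk s β := Quotient.sound h
      have h3 : (f α).1 = (f β).1 := by simp only [f, h2]
      rw [hα, hβ] at h3
      exact h3
    unfold SemiLatinSquare.concurrence at h1
    rw [card_eq_one] at h1
    obtain ⟨p, hp⟩ := h1
    have h4 : ∀ r, (L t r.1 r.2 = a ∧ L t' r.1 r.2 = c) ↔ r = p := by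
      intro r
      have := Finset.ext_iff.1 hp r
      simp only [mem_filter, mem_univ, true_and, mem_singleton, hL, hα, hβ] at this
      exact this
    exact ⟨p, (h4 p).2 rfl, fun r hr => (h4 r).1 hr⟩
  · intro α i j
    rw [he]
    exact hL α i j

lemma backward {μ : ℕ} (h : S.IsInflatedMOLSSuperposition μ) (α β : Fin (n * k)) :
    S.concurrence α β = 0 ∨ S.concurrence α β = 1 ∨ S.concurrence α β = n := by
  obtain ⟨L, ⟨-, hO⟩, e, he⟩ := h
  by_cases ht : (e α).1.1 = (e β).1.1
  · by_cases ha : (e α).1.2 = (e β).1.2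
    · right; right
      rw [conc_eq_n]
      intro i
      symm
      rw [← mem_iff, he, ← ht, ← ha, ← he, mem_iff]
    · left
      unfold SemiLatinSquare.concurrence
      rw [card_eq_zero, filter_eq_empty_iff]
      rintro p - ⟨h1, h2⟩
      rw [he] at h1 h2
      rw [← ht] at h2
      exact ha (h1.symm.trans h2)
  · right; left
    obtain ⟨p, hp, hp'⟩ := hO _ _ ht (e α).1.2 (e β).1.2
    unfold SemiLatinSquare.concurrence
    rw [card_eq_one]
    refine ⟨p, ?_⟩
    ext r
    simp only [mem_filter, mem_univ, true_and, mem_singleton, he]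
    constructor
    · exact hp' r
    · rintro rfl; exact hp

end SLSAux

/-- Theorem 5, equivalence of conditions 1 and 3: for a uniform `(n×n)/k` semi-Latin
square `S` (`n > 2`) with `μ = k/(n−1)`, `η₀(S) = nk²/2` holds iff `S` is a `μ`-fold
inflation of a superposition of `n−1` mutually orthogonal Latin squares of order `n`
(with pairwise disjoint symbol sets). -/
theorem eta_zero_sls_equality_iff_inflated_MOLS (n k μ : ℕ) (hn : 2 < n) (hμ : 0 < μ)
    (hk : k = μ * (n - 1)) (S : SemiLatinSquare n k) (hS : S.IsUniform) :
    (S.eta 0 : ℚ) = (n : ℚ) * (k : ℚ) ^ 2 / 2 ↔ S.IsInflatedMOLSSuperposition μ := by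
  obtain ⟨μ', hU⟩ := hS
  have h1 := SLSAux.k_eq S hn hU
  have h2 : μ' = μ := Nat.eq_of_mul_eq_mul_right (by omega : 0 < n - 1) (h1.symm.trans hk)
  subst h2
  rw [SLSAux.eta_iff S hn hU]
  exact ⟨SLSAux.forward S hn hU, fun h => SLSAux.backward S h⟩
end

section
/- Let n > 2 and suppose there exist n−1 mutually orthogonal Latin squares of order n. Let μ be a positive integer and let k = μ(n−1). Then a uniform (n×n)/k semi-Latin square has minimum PV aberration in the class of all uniform (n×n)/k semi-Latin squares if and only if it is a μ-fold inflation of a superposition of n−1 mutually orthogonal Latin squares of order n (with pairwise disjoint symbol sets). -/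
open Polynomial

namespace SemiLatinSquare

variable {n k : ℕ}

noncomputable def col (S : SemiLatinSquare n k) (α : Fin (n * k)) (i : Fin n) : Fin n :=
  (S.row_once i α).choose

theorem mem_iff (S : SemiLatinSquare n k) (α : Fin (n * k)) (i j : Fin n) :
    α ∈ S.block i j ↔ S.col α i = j := by
  have h := (S.row_once i α).choose_spec
  constructor
  · intro hm
    exact (h.2 j hm).symm
  · rintro rfl
    exact h.1

theorem col_inj (S : SemiLatinSquare n k) (α : Fin (n * k)) : Function.Injective (S.col α) := by
  intro i i' h
  exact (S.col_once (S.col α i') α).unique ((S.mem_iff _ _ _).2 h) ((S.mem_iff _ _ _).2 rfl)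

theorem col_surj (S : SemiLatinSquare n k) (α : Fin (n * k)) : Function.Surjective (S.col α) :=
  Finite.surjective_of_injective (S.col_inj α)

theorem conc_eq (S : SemiLatinSquare n k) (α β : Fin (n * k)) :
    S.concurrence α β = (Finset.univ.filter fun i => S.col β i = S.col α i).card := by
  unfold concurrence
  symm
  apply Finset.card_bij (fun i _ => (i, S.col α i))
  · intro i hi
    simp only [Finset.mem_filter, Finset.mem_univ, true_and, mem_iff] at hi ⊢
    exact hi
  · intro i _ j _ h
    exact (Prod.ext_iff.1 h).1
  · rintro ⟨i, j⟩ h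
    simp only [Finset.mem_filter, Finset.mem_univ, true_and, mem_iff] at h
    refine ⟨i, by simp [h.1, h.2], by simp [h.1]⟩

theorem conc_comm (S : SemiLatinSquare n k) (α β : Fin (n * k)) :
    S.concurrence α β = S.concurrence β α := by
  unfold concurrence
  simp only [and_comm]

theorem conc_le (S : SemiLatinSquare n k) (α β : Fin (n * k)) : S.concurrence α β ≤ n := by
  rw [conc_eq]
  exact (Finset.card_le_univ _).trans (by simp)

theorem conc_eq_n (S : SemiLatinSquare n k) (α β : Fin (n * k)) :
    S.concurrence α β = n ↔ S.col β = S.col α := by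
  rw [conc_eq]
  constructor
  · intro h
    have : (Finset.univ.filter fun i => S.col β i = S.col α i) = Finset.univ := by
      apply Finset.eq_univ_of_card
      simpa using h
    funext i
    have hi := Finset.mem_univ i
    rw [← this] at hi
    simpa using hi
  · intro h
    simp [h]

theorem conc_self (S : SemiLatinSquare n k) (α : Fin (n * k)) : S.concurrence α α = n :=
  (S.conc_eq_n α α).2 rfl

theorem conc_pos (S : SemiLatinSquare n k) (α β : Fin (n * k)) (i : Fin n)
    (h : S.col β i = S.col α i) : 0 < S.concurrence α β := by
  rw [conc_eq]
  exact Finset.card_pos.2 ⟨i, by simpa using h⟩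

theorem inter_row (S : SemiLatinSquare n k) (i j j' : Fin n) (h : j ≠ j') :
    (S.block i j ∩ S.block i j').card = 0 := by
  rw [Finset.card_eq_zero, Finset.eq_empty_iff_forall_notMem]
  intro α hα
  simp only [Finset.mem_inter, mem_iff] at hα
  exact h (hα.1.symm.trans hα.2)

theorem inter_col (S : SemiLatinSquare n k) (i i' j : Fin n) (h : i ≠ i') :
    (S.block i j ∩ S.block i' j).card = 0 := by
  rw [Finset.card_eq_zero, Finset.eq_empty_iff_forall_notMem]
  intro α hα
  simp only [Finset.mem_inter, mem_iff] at hα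
  exact h (S.col_inj α (hα.1.trans hα.2.symm))

theorem local_sum (S : SemiLatinSquare n k) (α : Fin (n * k)) (A : Finset (Fin (n * k))) :
    ∑ β ∈ A, S.concurrence α β = ∑ i', (A ∩ S.block i' (S.col α i')).card := by
  simp only [conc_eq, Finset.card_filter]
  rw [Finset.sum_comm]
  refine Finset.sum_congr rfl fun i _ => ?_
  rw [← Finset.card_filter]
  congr 1
  ext β
  simp [mem_iff]

theorem global_sum (S : SemiLatinSquare n k) (α : Fin (n * k)) :
    ∑ β, S.concurrence α β = n * k := by
  rw [local_sum]
  simp [S.blockSize]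

theorem local_sum_in (S : SemiLatinSquare n k) {μ : ℕ} (hS : S.UniformWith μ) (α : Fin (n * k))
    (i j : Fin n) (h : S.col α i = j) :
    ∑ β ∈ S.block i j, S.concurrence α β = k + (n - 1) * μ := by
  rw [local_sum, ← Finset.add_sum_erase _ _ (Finset.mem_univ i), h, Finset.inter_self, S.blockSize]
  congr 1
  rw [Finset.sum_congr rfl (g := fun _ => μ)]
  · simp
  · intro i' hi'
    have hi' := Finset.ne_of_mem_erase hi'
    apply hS.2 _ _ _ _ hi'.symm
    rw [← h]
    exact fun h' => hi' (S.col_inj α h').symm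

theorem local_sum_out (S : SemiLatinSquare n k) {μ : ℕ} (hS : S.UniformWith μ) (α : Fin (n * k))
    (i j : Fin n) (h : S.col α i ≠ j) :
    ∑ β ∈ S.block i j, S.concurrence α β = (n - 2) * μ := by
  obtain ⟨i0, hi0⟩ := S.col_surj α j
  have hne : i0 ≠ i := by rintro rfl; exact h hi0
  rw [local_sum, ← Finset.add_sum_erase _ _ (Finset.mem_univ i),
    ← Finset.add_sum_erase _ _ (Finset.mem_erase.2 ⟨hne, Finset.mem_univ i0⟩),
    S.inter_row i _ _ (Ne.symm h), hi0, S.inter_col _ _ _ hne.symm]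
  rw [Finset.sum_congr rfl (g := fun _ => μ)]
  · rw [Finset.sum_const, Finset.card_erase_of_mem (Finset.mem_erase.2 ⟨hne, Finset.mem_univ i0⟩),
      Finset.card_erase_of_mem (Finset.mem_univ i)]
    simp [Nat.sub_sub]
  · intro i' hi'
    simp only [Finset.mem_erase, Finset.mem_univ, and_true] at hi'
    apply hS.2 _ _ _ _ (Ne.symm hi'.2)
    rw [← hi0]
    exact fun h' => hi'.1 (S.col_inj α h').symm

theorem uniform_param (S : SemiLatinSquare n k) {μ : ℕ} (hn : 2 < n) (hS : S.UniformWith μ) :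
    k = μ * (n - 1) := by
  let i : Fin n := ⟨0, by omega⟩
  let i' : Fin n := ⟨1, by omega⟩
  have hne : i ≠ i' := by simp [i, i']
  have h1 : (S.block i i).card = ∑ j, (S.block i i ∩ S.block i' j).card := by
    rw [Finset.card_eq_sum_card_fiberwise (f := fun β => S.col β i') (t := Finset.univ) (by simp)]
    refine Finset.sum_congr rfl fun j _ => ?_
    congr 1
    ext β
    simp [mem_iff]
  rw [S.blockSize, ← Finset.add_sum_erase _ _ (Finset.mem_univ i), S.inter_col _ _ _ hne,
    Finset.sum_congr rfl (g := fun _ => μ)] at h1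
  · rw [h1]; simp [mul_comm]
  · intro j hj
    exact hS.2 _ _ _ _ hne (Finset.ne_of_mem_erase hj).symm

theorem sq_sum (S : SemiLatinSquare n k) {μ : ℕ} (hS : S.UniformWith μ) (α : Fin (n * k)) :
    ∑ β, S.concurrence α β ^ 2 = n * (k + (n - 1) * μ) := by
  have : ∀ β, S.concurrence α β ^ 2 =
      ∑ i, if β ∈ S.block i (S.col α i) then S.concurrence α β else 0 := by
    intro β
    rw [← Finset.sum_filter, Finset.sum_const, sq, smul_eq_mul]
    congr 1
    rw [conc_eq]
    congr 1
    ext i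
    simp [mem_iff]
  simp only [this]
  rw [Finset.sum_comm]
  have : ∀ i, (∑ β, if β ∈ S.block i (S.col α i) then S.concurrence α β else 0)
      = k + (n - 1) * μ := by
    intro i
    rw [← S.local_sum_in hS α i _ rfl, Finset.sum_ite_mem, Finset.univ_inter]
  simp [this]

/-- all concurrences in {0,1,n} -/
def Good (S : SemiLatinSquare n k) : Prop :=
  ∀ α β, S.concurrence α β = 0 ∨ S.concurrence α β = 1 ∨ S.concurrence α β = n

end SemiLatinSquare

theorem sym_sum {N : ℕ} (g : Fin N → Fin N → ℤ) (hg : ∀ a b, g a b = g b a) :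
    ∑ a, ∑ b, g a b =
      2 * (∑ p ∈ Finset.univ.filter (fun p : Fin N × Fin N => p.1 < p.2), g p.1 p.2)
        + ∑ a, g a a := by
  have h1 : ∑ p ∈ Finset.univ.filter (fun p : Fin N × Fin N => p.1 < p.2), g p.1 p.2
      = ∑ a, ∑ b, if a < b then g a b else 0 := by
    rw [Finset.sum_filter, Fintype.sum_prod_type]
  have h2 : ∑ p ∈ Finset.univ.filter (fun p : Fin N × Fin N => p.1 < p.2), g p.1 p.2
      = ∑ a, ∑ b, if b < a then g a b else 0 := by
    rw [h1, Finset.sum_comm]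
    simp only [hg]
  have h3 : ∑ a, g a a = ∑ a, ∑ b, if a = b then g a b else 0 := by simp
  rw [two_mul]
  nth_rw 1 [h1]
  rw [h2, h3, ← Finset.sum_add_distrib, ← Finset.sum_add_distrib]
  refine Finset.sum_congr rfl fun a _ => ?_
  rw [← Finset.sum_add_distrib, ← Finset.sum_add_distrib]
  refine Finset.sum_congr rfl fun b _ => ?_
  rcases lt_trichotomy a b with h | h | h
  · simp [h, h.not_gt, h.ne]
  · simp [h]
  · simp [h, h.not_gt, h.ne']

namespace SemiLatinSquare

variable {n k : ℕ}

/-- the index set of unordered pairs -/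
def prs (n k : ℕ) : Finset (Fin (n * k) × Fin (n * k)) :=
  Finset.univ.filter (fun p => p.1 < p.2)

theorem pair_sum1 (S : SemiLatinSquare n k) :
    2 * (∑ p ∈ prs n k, (S.concurrence p.1 p.2 : ℤ)) = (n * k) * (n * k) - (n * k) * n := by
  have h := sym_sum (fun a b => (S.concurrence a b : ℤ)) (fun a b => by rw [conc_comm])
  have h1 : ∀ a, ∑ b, (S.concurrence a b : ℤ) = n * k := by
    intro a
    exact_mod_cast S.global_sum a
  simp only [h1, conc_self] at h
  simp at h
  unfold prs
  linarith

theorem pair_sum2 (S : SemiLatinSquare n k) {μ : ℕ} (hS : S.UniformWith μ) :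
    2 * (∑ p ∈ prs n k, (S.concurrence p.1 p.2 : ℤ) ^ 2) =
      (n * k) * (n * (k + (n - 1 : ℕ) * μ)) - (n * k) * n ^ 2 := by
  have h := sym_sum (fun a b => (S.concurrence a b : ℤ) ^ 2) (fun a b => by rw [conc_comm])
  have h1 : ∀ a, ∑ b, (S.concurrence a b : ℤ) ^ 2 = n * (k + (n - 1 : ℕ) * μ) := by
    intro a
    exact_mod_cast S.sq_sum hS a
  simp only [h1, conc_self] at h
  simp only [Finset.sum_const, Finset.card_univ, Fintype.card_fin, nsmul_eq_mul, Nat.cast_mul] at h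
  unfold prs
  linarith

theorem eta_eq (S : SemiLatinSquare n k) (i : ℕ) :
    (S.eta i : ℤ) = ∑ p ∈ prs n k, if S.concurrence p.1 p.2 = i then 1 else 0 := by
  unfold eta prs
  rw [← Finset.filter_filter, Finset.card_filter]
  push_cast
  rfl

/-- the excess -/
def exc (S : SemiLatinSquare n k) (p : Fin (n * k) × Fin (n * k)) : ℤ :=
  ((S.concurrence p.1 p.2 : ℤ) - 1) * (n - S.concurrence p.1 p.2)
    + n * (if S.concurrence p.1 p.2 = 0 then 1 else 0)

theorem exc_nonneg (S : SemiLatinSquare n k) (p) : 0 ≤ S.exc p := by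
  unfold exc
  have h := S.conc_le p.1 p.2
  rcases Nat.eq_zero_or_pos (S.concurrence p.1 p.2) with h0 | h0
  · simp [h0]
  · rw [if_neg h0.ne']
    have : (0 : ℤ) ≤ (S.concurrence p.1 p.2 : ℤ) - 1 := by omega
    have : (0 : ℤ) ≤ (n : ℤ) - (S.concurrence p.1 p.2 : ℤ) := by omega
    have := mul_nonneg ‹(0 : ℤ) ≤ (S.concurrence p.1 p.2 : ℤ) - 1› this
    linarith

theorem exc_zero (S : SemiLatinSquare n k) (p) : S.exc p = 0 ↔
    (S.concurrence p.1 p.2 = 0 ∨ S.concurrence p.1 p.2 = 1 ∨ S.concurrence p.1 p.2 = n) := by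
  unfold exc
  rcases Nat.eq_zero_or_pos (S.concurrence p.1 p.2) with h0 | h0
  · simp [h0]
  · rw [if_neg h0.ne', mul_zero, add_zero, mul_eq_zero]
    omega

theorem sum_exc (S : SemiLatinSquare n k) :
    ∑ p ∈ prs n k, S.exc p = (n + 1) * (∑ p ∈ prs n k, (S.concurrence p.1 p.2 : ℤ))
      - (∑ p ∈ prs n k, (S.concurrence p.1 p.2 : ℤ) ^ 2) - n * (prs n k).card + n * S.eta 0 := by
  rw [eta_eq, Finset.mul_sum, Finset.mul_sum, ← nsmul_eq_mul', ← Finset.sum_const,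
    ← Finset.sum_sub_distrib, ← Finset.sum_sub_distrib, ← Finset.sum_add_distrib]
  refine Finset.sum_congr rfl fun p _ => ?_
  unfold exc
  ring

theorem sum_exc_eq (S T : SemiLatinSquare n k) {μ : ℕ} (hS : S.UniformWith μ)
    (hT : T.UniformWith μ) :
    ∑ p ∈ prs n k, S.exc p - n * S.eta 0 = ∑ p ∈ prs n k, T.exc p - n * T.eta 0 := by
  rw [sum_exc, sum_exc]
  have h1 := S.pair_sum1.trans T.pair_sum1.symm
  have h2 := (S.pair_sum2 hS).trans (T.pair_sum2 hT).symm
  have h1' := mul_left_cancel₀ (by norm_num) h1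
  have h2' := mul_left_cancel₀ (by norm_num) h2
  rw [h1', h2']
  ring

theorem good_iff (S : SemiLatinSquare n k) : S.Good ↔ ∑ p ∈ prs n k, S.exc p = 0 := by
  rw [Finset.sum_eq_zero_iff_of_nonneg (fun p _ => S.exc_nonneg p)]
  simp only [exc_zero]
  constructor
  · intro h p _
    exact h _ _
  · intro h α β
    rcases lt_trichotomy α β with h' | h' | h'
    · exact h (α, β) (by simp [prs, h'])
    · subst h'
      exact Or.inr (Or.inr (S.conc_self α))
    · rw [conc_comm]
      exact h (β, α) (by simp [prs, h'])

theorem eta0_le (S T : SemiLatinSquare n k) {μ : ℕ} (hn : 2 < n) (hS : S.UniformWith μ)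
    (hT : T.UniformWith μ) (hg : S.Good) : S.eta 0 ≤ T.eta 0 := by
  have h := sum_exc_eq S T hS hT
  rw [S.good_iff.1 hg] at h
  have h' := Finset.sum_nonneg (fun p (_ : p ∈ prs n k) => T.exc_nonneg p)
  by_contra! hlt
  have : (T.eta 0 : ℤ) < S.eta 0 := by exact_mod_cast hlt
  have hn' : (0 : ℤ) < n := by omega
  nlinarith

theorem good_of_eta0 (S T : SemiLatinSquare n k) {μ : ℕ} (hS : S.UniformWith μ)
    (hT : T.UniformWith μ) (hg : S.Good) (h0 : T.eta 0 ≤ S.eta 0) : T.Good := by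
  have h := sum_exc_eq S T hS hT
  rw [S.good_iff.1 hg] at h
  have h' := Finset.sum_nonneg (fun p (_ : p ∈ prs n k) => T.exc_nonneg p)
  rw [good_iff]
  have : (T.eta 0 : ℤ) ≤ S.eta 0 := by exact_mod_cast h0
  nlinarith

theorem good_sum1 (S : SemiLatinSquare n k) (hn : 2 < n) (hg : S.Good) :
    (∑ p ∈ prs n k, (S.concurrence p.1 p.2 : ℤ)) = S.eta 1 + n * S.eta n := by
  rw [eta_eq, eta_eq, Finset.mul_sum, ← Finset.sum_add_distrib]
  refine Finset.sum_congr rfl fun p _ => ?_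
  rcases hg p.1 p.2 with h | h | h <;> rw [h]
  · simp; omega
  · simp; omega
  · simp; omega

theorem good_sum2 (S : SemiLatinSquare n k) (hn : 2 < n) (hg : S.Good) :
    (∑ p ∈ prs n k, (S.concurrence p.1 p.2 : ℤ) ^ 2) = S.eta 1 + n ^ 2 * S.eta n := by
  rw [eta_eq, eta_eq, Finset.mul_sum, ← Finset.sum_add_distrib]
  refine Finset.sum_congr rfl fun p _ => ?_
  rcases hg p.1 p.2 with h | h | h <;> rw [h]
  · simp; omega
  · simp; omega
  · simp; omega

theorem eta_other (S : SemiLatinSquare n k) (hg : S.Good) (i : ℕ) (h0 : i ≠ 0)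
    (h1 : i ≠ 1) (h2 : i ≠ n) : S.eta i = 0 := by
  unfold eta
  rw [Finset.card_eq_zero, Finset.filter_eq_empty_iff]
  rintro p _ ⟨_, h⟩
  rcases hg p.1 p.2 with h' | h' | h' <;> omega

theorem eta_all (S T : SemiLatinSquare n k) {μ : ℕ} (hn : 2 < n) (hS : S.UniformWith μ)
    (hT : T.UniformWith μ) (hg : S.Good) (hg' : T.Good) : S.eta = T.eta := by
  have h0 := le_antisymm (eta0_le S T hn hS hT hg) (eta0_le T S hn hT hS hg')
  have h1 := S.pair_sum1.trans T.pair_sum1.symm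
  have h2 := (S.pair_sum2 hS).trans (T.pair_sum2 hT).symm
  rw [S.good_sum1 hn hg, T.good_sum1 hn hg'] at h1
  rw [S.good_sum2 hn hg, T.good_sum2 hn hg'] at h2
  have hn' : (2 : ℤ) < n := by omega
  have h3 : ((n : ℤ) * (n - 1)) * (S.eta n - T.eta n) = 0 := by linarith
  have h4 : (S.eta n : ℤ) - T.eta n = 0 := by
    rcases mul_eq_zero.1 h3 with h | h
    · exfalso
      rcases mul_eq_zero.1 h with h | h <;> omega
    · exact h
  have h5 : (S.eta n : ℤ) = T.eta n := by linarith
  rw [h5] at h1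
  have h6 : (S.eta 1 : ℤ) = T.eta 1 := by linarith
  funext i
  by_cases i0 : i = 0
  · rw [i0, h0]
  by_cases i1 : i = 1
  · rw [i1]; exact_mod_cast h6
  by_cases i2 : i = n
  · rw [i2]; exact_mod_cast h5
  rw [S.eta_other hg i i0 i1 i2, T.eta_other hg' i i0 i1 i2]

theorem etaVec_cons (S : SemiLatinSquare n k) :
    S.etaVec = S.eta 0 :: (List.range n).map (S.eta ∘ Nat.succ) := by
  unfold etaVec
  rw [List.range_succ_eq_map]
  simp

theorem min_of_good (S : SemiLatinSquare n k) {μ : ℕ} (hn : 2 < n) (hS : S.UniformWith μ)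
    (hg : S.Good) (hu : ∀ T : SemiLatinSquare n k, T.IsUniform → T.UniformWith μ) :
    S.MinPVAberration := by
  intro T hT hlex
  have hT := hu T hT
  have h1 := eta0_le S T hn hS hT hg
  rcases h1.eq_or_lt with h | h
  · have := good_of_eta0 S T hS hT hg h.ge
    have h2 := eta_all S T hn hS hT hg this
    have h3 : S.etaVec = T.etaVec := by unfold etaVec; rw [h2]
    rw [h3] at hlex
    exact (List.lt_irrefl T.etaVec) hlex
  · rw [etaVec_cons, etaVec_cons] at hlex
    generalize S.eta 0 = a at *
    generalize T.eta 0 = b at *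
    cases hlex <;> omega

theorem good_of_min (S T : SemiLatinSquare n k) {μ : ℕ} (hS : S.UniformWith μ)
    (hT : T.UniformWith μ) (hg : T.Good) (hm : S.MinPVAberration) : S.Good := by
  apply good_of_eta0 T S hT hS hg
  by_contra! h
  apply hm T ⟨μ, hT⟩
  rw [etaVec_cons, etaVec_cons]
  exact List.Lex.rel h

end SemiLatinSquare

namespace SemiLatinSquare

variable {n k : ℕ}

/-- parallel or equal -/
def par (S : SemiLatinSquare n k) (α β : Fin (n * k)) : Prop :=
  S.concurrence α β = 0 ∨ S.concurrence α β = n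

theorem par_symm (S : SemiLatinSquare n k) {α β : Fin (n * k)} (h : S.par α β) : S.par β α := by
  unfold par at *
  rwa [conc_comm]

theorem par_refl (S : SemiLatinSquare n k) (α : Fin (n * k)) : S.par α α :=
  Or.inr (S.conc_self α)

theorem par_meet (S : SemiLatinSquare n k) {α β : Fin (n * k)} (h : S.par α β) {i : Fin n}
    (hi : S.col β i = S.col α i) : S.col β = S.col α := by
  have := S.conc_pos α β i hi
  rcases h with h | h
  · omega
  · exact (S.conc_eq_n _ _).1 h

theorem conc_congr (S : SemiLatinSquare n k) {α β γ : Fin (n * k)} (h : S.col β = S.col γ) :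
    S.concurrence α β = S.concurrence α γ := by
  rw [conc_eq, conc_eq, h]

theorem sum_block (S : SemiLatinSquare n k) {α : Fin (n * k)} {i j : Fin n} {a b : ℕ}
    (P : Fin (n * k) → Prop) [DecidablePred P]
    (h1 : ∀ β ∈ S.block i j, P β → S.concurrence α β = a)
    (h2 : ∀ β ∈ S.block i j, ¬ P β → S.concurrence α β = b) :
    ∑ β ∈ S.block i j, S.concurrence α β =
      ((S.block i j).filter P).card * a + ((S.block i j).filter (fun β => ¬ P β)).card * b := by
  rw [← Finset.sum_filter_add_sum_filter_not (S.block i j) P]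
  congr 1
  · rw [Finset.sum_congr rfl (g := fun _ => a), Finset.sum_const, smul_eq_mul]
    intro β hβ
    rw [Finset.mem_filter] at hβ
    exact h1 β hβ.1 hβ.2
  · rw [Finset.sum_congr rfl (g := fun _ => b), Finset.sum_const, smul_eq_mul]
    intro β hβ
    rw [Finset.mem_filter] at hβ
    exact h2 β hβ.1 hβ.2

open Classical in
theorem fib_card (S : SemiLatinSquare n k) {μ : ℕ} (hn : 2 < n) (hS : S.UniformWith μ)
    (hg : S.Good) (α : Fin (n * k)) (i j : Fin n) :
    ((S.block i j).filter (fun β => S.par α β)).card = μ := by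
  have hk := S.uniform_param hn hS
  have hc := Finset.card_filter_add_card_filter_not (s := S.block i j) (fun β => S.par α β)
  rw [S.blockSize] at hc
  obtain ⟨m, rfl⟩ : ∃ m, n = m + 3 := ⟨n - 3, by omega⟩
  by_cases h : S.col α i = j
  · have h1 := S.local_sum_in hS α i j h
    rw [S.sum_block (a := m + 3) (b := 1) (fun β => S.par α β)] at h1
    · simp only [show m + 3 - 1 = m + 2 by omega] at *
      have : (m + 2) * ((S.block i j).filter (fun β => S.par α β)).card = (m + 2) * μ := by
        nlinarith
      exact Nat.eq_of_mul_eq_mul_left (by omega) this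
    · intro β hβ hp
      rw [mem_iff] at hβ
      exact (S.conc_eq_n _ _).2 (S.par_meet hp (hβ.trans h.symm))
    · intro β _ hp
      have := hg α β
      unfold par at hp
      omega
  · have h1 := S.local_sum_out hS α i j h
    rw [S.sum_block (a := 0) (b := 1) (fun β => S.par α β)] at h1
    · simp only [show m + 3 - 1 = m + 2 by omega, show m + 3 - 2 = m + 1 by omega] at *
      nlinarith
    · intro β hβ hp
      rw [mem_iff] at hβ
      rcases hp with hp | hp
      · exact hp
      · exfalso
        apply h
        rw [← (S.conc_eq_n _ _).1 hp, hβ]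
    · intro β _ hp
      have := hg α β
      unfold par at hp
      omega

theorem par_unique (S : SemiLatinSquare n k) {μ : ℕ} (hn : 2 < n) (hS : S.UniformWith μ)
    (hg : S.Good) {α β γ : Fin (n * k)} (h1 : S.par α β) (h2 : S.par α γ) {i : Fin n}
    (hi : S.col β i = S.col γ i) : S.col β = S.col γ := by
  classical
  have hsub : (S.block i (S.col γ i)).filter (fun δ => S.par β δ) ⊆
      (S.block i (S.col γ i)).filter (fun δ => S.par α δ) := by
    intro δ hδ
    rw [Finset.mem_filter, mem_iff] at hδ ⊢
    refine ⟨hδ.1, ?_⟩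
    have := S.par_meet hδ.2 (hδ.1.trans hi.symm)
    unfold par
    rw [S.conc_congr this]
    exact h1
  have heq := Finset.eq_of_subset_of_card_le hsub
    (by rw [S.fib_card hn hS hg, S.fib_card hn hS hg])
  have hm : γ ∈ (S.block i (S.col γ i)).filter (fun δ => S.par α δ) := by
    rw [Finset.mem_filter, mem_iff]
    exact ⟨rfl, h2⟩
  rw [← heq, Finset.mem_filter] at hm
  exact (S.par_meet hm.2 hi.symm).symm

theorem par_trans (S : SemiLatinSquare n k) {μ : ℕ} (hn : 2 < n) (hS : S.UniformWith μ)
    (hg : S.Good) {α β γ : Fin (n * k)} (h1 : S.par α β) (h2 : S.par β γ) : S.par α γ := by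
  by_contra h
  have hpos : 0 < S.concurrence α γ := by
    unfold par at h
    omega
  rw [conc_eq] at hpos
  obtain ⟨i, hi⟩ := Finset.card_pos.1 hpos
  simp only [Finset.mem_filter, Finset.mem_univ, true_and] at hi
  exact h (Or.inr ((S.conc_eq_n _ _).2 (S.par_unique hn hS hg h2 (S.par_symm h1) hi)))

theorem inflated_of_good (S : SemiLatinSquare n k) {μ : ℕ} (hn : 2 < n) (hS : S.UniformWith μ)
    (hg : S.Good) : S.IsInflatedMOLSSuperposition μ := by
  classical
  have hk := S.uniform_param hn hS
  have hμ := hS.1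
  let st : Setoid (Fin (n * k)) := ⟨S.par, S.par_refl, S.par_symm, S.par_trans hn hS hg⟩
  let Q := Quotient st
  let z : Fin n := ⟨0, by omega⟩
  let f : Fin (n * k) → Q × Fin n := fun α => (Quotient.mk st α, S.col α z)
  have hmk : ∀ α β, (Quotient.mk st α : Q) = Quotient.mk st β ↔ S.par α β :=
    fun α β => Quotient.eq (r := st)
  have hf : ∀ q : Q × Fin n, Fintype.card {α // f α = q} = μ := by
    rintro ⟨q, j⟩
    obtain ⟨α, rfl⟩ := Quotient.exists_rep q
    rw [Fintype.card_subtype, ← S.fib_card hn hS hg α z j]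
    congr 1
    ext β
    rw [Finset.mem_filter, Finset.mem_filter, mem_iff]
    simp only [f, Prod.mk.injEq, Finset.mem_univ, true_and]
    rw [hmk]
    constructor
    · rintro ⟨a, b⟩; exact ⟨b, S.par_symm a⟩
    · rintro ⟨a, b⟩; exact ⟨S.par_symm b, a⟩
  let e0 : Fin (n * k) ≃ (Q × Fin n) × Fin μ :=
    (Equiv.sigmaFiberEquiv f).symm.trans
      ((Equiv.sigmaCongrRight fun q => Fintype.equivFinOfCardEq (hf q)).trans
        (Equiv.sigmaEquivProd _ _))
  have he0 : ∀ α, (e0 α).1 = f α := fun α => rfl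
  have hQ : Fintype.card Q = n - 1 := by
    have h := Fintype.card_congr e0
    simp only [Fintype.card_prod, Fintype.card_fin] at h
    generalize Fintype.card Q = c at h ⊢
    have h2 : n * k = n * (μ * (n - 1)) := congrArg (n * ·) hk
    rw [h2] at h
    have h' : (n * μ) * c = (n * μ) * (n - 1) := by
      rw [mul_assoc n μ (n - 1), h]; ring
    exact Nat.eq_of_mul_eq_mul_left (Nat.mul_pos (by omega) hμ) h'
  let eQ : Q ≃ Fin (n - 1) := Fintype.equivFinOfCardEq hQ
  let e : Fin (n * k) ≃ (Fin (n - 1) × Fin n) × Fin μ :=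
    e0.trans ((eQ.prodCongr (Equiv.refl _)).prodCongr (Equiv.refl _))
  have he : ∀ α, (e α).1 = (eQ (Quotient.mk st α), S.col α z) := fun α => rfl
  have hex : ∀ (t : Fin (n - 1)) (i j : Fin n), ∃ α, eQ (Quotient.mk st α) = t ∧ S.col α i = j := by
    intro t i j
    obtain ⟨α, hα⟩ := Quotient.exists_rep (eQ.symm t)
    have h := S.fib_card hn hS hg α i j
    obtain ⟨β, hβ⟩ := Finset.card_pos.1 (by rw [h]; exact hμ)
    rw [Finset.mem_filter, mem_iff] at hβ
    refine ⟨β, ?_, hβ.1⟩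
    rw [(hmk β α).2 (S.par_symm hβ.2), hα, Equiv.apply_symm_apply]
  choose rep hrep1 hrep2 using hex
  let L : Fin (n - 1) → Fin n → Fin n → Fin n := fun t i j => S.col (rep t i j) z
  have hL : ∀ α i j, L (eQ (Quotient.mk st α)) i j = S.col α z ↔ S.col α i = j := by
    intro α i j
    have hp : S.par α (rep (eQ (Quotient.mk st α)) i j) := by
      rw [← hmk]
      exact (eQ.injective (hrep1 _ i j)).symm
    constructor
    · intro h
      rw [← S.par_meet hp h, hrep2]
    · intro h
      have := S.par_meet hp (i := i) (by rw [hrep2, h])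
      exact congrFun this z
  refine ⟨L, ⟨?_, ?_⟩, e, ?_⟩
  · intro t
    constructor
    · intro i a
      have h := hL (rep t z a) i
      rw [hrep1, hrep2] at h
      exact ⟨_, (h _).2 rfl, fun j hj => ((h j).1 hj).symm⟩
    · intro j a
      have h := fun i => hL (rep t z a) i j
      simp only [hrep1, hrep2] at h
      obtain ⟨i, hi⟩ := S.col_surj (rep t z a) j
      exact ⟨i, (h _).2 hi, fun i' hi' => S.col_inj _ (((h i').1 hi').trans hi.symm)⟩
  · intro t t' htt a b
    have h1 := hL (rep t z a)
    have h2 := hL (rep t' z b)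
    simp only [hrep1, hrep2] at h1 h2
    have hnp : ¬ S.par (rep t z a) (rep t' z b) := by
      intro h
      rw [← hmk] at h
      apply htt
      rw [← hrep1 t z a, ← hrep1 t' z b, h]
    have hone : S.concurrence (rep t z a) (rep t' z b) = 1 := by
      have := hg (rep t z a) (rep t' z b)
      unfold par at hnp
      omega
    unfold concurrence at hone
    obtain ⟨p, hp⟩ := Finset.card_eq_one.1 hone
    refine ⟨p, ?_, ?_⟩
    · have : p ∈ ({p} : Finset _) := Finset.mem_singleton_self p
      rw [← hp] at this
      simpa [mem_iff, h1, h2] using this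
    · intro q hq
      rw [← Finset.mem_singleton, ← hp]
      simpa [mem_iff, h1, h2] using hq
  · intro α i j
    rw [mem_iff, he, hL]

theorem good_of_inflated (S : SemiLatinSquare n k) {μ : ℕ}
    (h : S.IsInflatedMOLSSuperposition μ) : S.Good := by
  obtain ⟨L, ⟨hlat, horth⟩, e, he⟩ := h
  intro α β
  by_cases ht : (e α).1.1 = (e β).1.1
  · by_cases ha : (e α).1.2 = (e β).1.2
    · right; right
      rw [conc_eq_n]
      funext i
      rw [← mem_iff, he, ← ht, ← ha, ← he, mem_iff]
    · left
      unfold concurrence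
      rw [Finset.card_eq_zero, Finset.filter_eq_empty_iff]
      rintro p _ ⟨h1, h2⟩
      rw [he] at h1 h2
      rw [← ht, h1] at h2
      exact ha h2
  · right; left
    unfold concurrence
    obtain ⟨p, hp, hu⟩ := horth _ _ ht (e α).1.2 (e β).1.2
    rw [Finset.card_eq_one]
    refine ⟨p, ?_⟩
    ext q
    simp only [Finset.mem_filter, Finset.mem_univ, true_and, he, Finset.mem_singleton]
    exact ⟨fun h => hu q h, fun h => h ▸ hp⟩

end SemiLatinSquare

theorem mols_agree {n : ℕ} (hn : 2 < n) (L : Fin (n - 1) → Fin n → Fin n → Fin n) (hL : IsMOLS L)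
    (i j i' j' : Fin n) (hi : i ≠ i') (hj : j ≠ j') : ∃! t, L t i j = L t i' j' := by
  obtain ⟨hlat, horth⟩ := hL
  choose g hg hu using fun t => (hlat t).1 i' (L t i j)
  have hgj : ∀ t, g t ≠ j := by
    intro t h
    have h1 := hg t
    rw [h] at h1
    exact hi (((hlat t).2 j (L t i j)).unique rfl h1)
  have hinj : Function.Injective (fun t => (⟨g t, hgj t⟩ : {x // x ≠ j})) := by
    intro t t' h
    by_contra htt
    have h : g t = g t' := congrArg Subtype.val h
    have h2 := (horth t t' htt (L t i j) (L t' i j)).unique (y₁ := (i, j)) (y₂ := (i', g t))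
      ⟨rfl, rfl⟩ ⟨hg t, by rw [h]; exact hg t'⟩
    exact hi (Prod.ext_iff.1 h2).1
  have hbij := (Fintype.bijective_iff_injective_and_card _).2 ⟨hinj, by simp⟩
  obtain ⟨t, ht⟩ := hbij.2 ⟨j', hj.symm⟩
  have ht : g t = j' := congrArg Subtype.val ht
  refine ⟨t, by rw [← ht]; exact (hg t).symm, ?_⟩
  intro t' ht'
  apply hinj
  apply Subtype.ext
  change g t' = g t
  rw [ht]
  exact (hu t' j' ht'.symm).symm

theorem card_prod_fin {A : Type*} [Fintype A] {N μ : ℕ} (e : Fin N ≃ A × Fin μ)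
    (P : A → Prop) [DecidablePred P] :
    (Finset.univ.filter fun α => P (e α).1).card = (Finset.univ.filter P).card * μ := by
  have : (Finset.univ.filter fun α => P (e α).1).card
      = ((Finset.univ.filter P) ×ˢ (Finset.univ : Finset (Fin μ))).card := by
    apply Finset.card_bij (fun α _ => e α)
    · intro α hα
      simpa using hα
    · intro α _ β _ h
      exact e.injective h
    · intro b hb
      exact ⟨e.symm b, by simpa using hb, by simp⟩
  rw [this, Finset.card_product]
  simp

theorem exists_inflated {n k μ : ℕ} (hn : 2 < n) (L : Fin (n - 1) → Fin n → Fin n → Fin n)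
    (hL : IsMOLS L) (hμ : 0 < μ) (hk : k = μ * (n - 1)) :
    ∃ S : SemiLatinSquare n k, S.UniformWith μ ∧ S.IsInflatedMOLSSuperposition μ := by
  have e : Fin (n * k) ≃ (Fin (n - 1) × Fin n) × Fin μ := by
    apply Fintype.equivOfCardEq
    simp only [Fintype.card_prod, Fintype.card_fin]
    rw [hk]; ring
  let S : SemiLatinSquare n k :=
    { block := fun i j => Finset.univ.filter fun α => L (e α).1.1 i j = (e α).1.2
      blockSize := by
        intro i j
        rw [card_prod_fin e (fun x => L x.1 i j = x.2), hk, mul_comm]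
        congr 1
        have : (Finset.univ.filter fun x : Fin (n - 1) × Fin n => L x.1 i j = x.2)
            = Finset.univ.image (fun t => (t, L t i j)) := by
          ext ⟨t, a⟩
          simp
        rw [this, Finset.card_image_of_injective _ (fun a b h => (Prod.ext_iff.1 h).1)]
        simp
      row_once := by
        intro i α
        simpa using (hL.1 (e α).1.1).1 i (e α).1.2
      col_once := by
        intro j α
        simpa using (hL.1 (e α).1.1).2 j (e α).1.2 }
  refine ⟨S, ⟨hμ, ?_⟩, L, hL, e, ?_⟩
  · intro i j i' j' hi hj
    obtain ⟨t, ht, hu⟩ := mols_agree hn L hL i j i' j' hi hj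
    change ((Finset.univ.filter fun α => L (e α).1.1 i j = (e α).1.2) ∩
      (Finset.univ.filter fun α => L (e α).1.1 i' j' = (e α).1.2)).card = μ
    rw [← Finset.filter_and, card_prod_fin e (fun x => L x.1 i j = x.2 ∧ L x.1 i' j' = x.2)]
    have : (Finset.univ.filter fun x : Fin (n - 1) × Fin n => L x.1 i j = x.2 ∧ L x.1 i' j' = x.2)
        = {(t, L t i j)} := by
      ext ⟨s, a⟩
      simp only [Finset.mem_filter, Finset.mem_univ, true_and, Finset.mem_singleton,
        Prod.mk.injEq]
      constructor
      · rintro ⟨h1, h2⟩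
        have := hu s (h1.trans h2.symm)
        subst this
        exact ⟨rfl, h1.symm⟩
      · rintro ⟨rfl, rfl⟩
        exact ⟨rfl, ht.symm⟩
    rw [this]
    simp
  · intro α i j
    simp [S]

/-- Corollary 6: if `n − 1` MOLS of order `n` exist (`n > 2`) and `k = μ(n−1)`, then a
uniform `(n×n)/k` semi-Latin square has minimum PV aberration in the class of all
uniform `(n×n)/k` semi-Latin squares iff it is a `μ`-fold inflation of a superposition
of `n−1` MOLS of order `n` (with pairwise disjoint symbol sets). -/
theorem min_PV_aberration_iff_inflated_MOLS (n k μ : ℕ) (hn : 2 < n)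
    (hMOLS : ∃ L : Fin (n - 1) → Fin n → Fin n → Fin n, IsMOLS L)
    (hμ : 0 < μ) (hk : k = μ * (n - 1)) :
    ∀ S : SemiLatinSquare n k, S.IsUniform →
      (S.MinPVAberration ↔ S.IsInflatedMOLSSuperposition μ) := by
  have hu : ∀ T : SemiLatinSquare n k, T.IsUniform → T.UniformWith μ := by
    rintro T ⟨μ', hT⟩
    have h := T.uniform_param hn hT
    have : μ' = μ := Nat.eq_of_mul_eq_mul_right (by omega) (h.symm.trans hk)
    rwa [← this]
  intro S hS
  have hS := hu S hS
  obtain ⟨L, hL⟩ := hMOLS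
  obtain ⟨T, hT, hTi⟩ := exists_inflated hn L hL hμ hk
  constructor
  · intro hm
    exact S.inflated_of_good hn hS (S.good_of_min T hS hT (T.good_of_inflated hTi) hm)
  · intro h
    exact S.min_of_good hn hS (S.good_of_inflated h) hu
end

section
/- Let n > 2 and let L₁,…,L_{n−1} be n−1 mutually orthogonal Latin squares of order n with pairwise disjoint symbol sets. Then the superposition of L₁,…,L_{n−1} is a uniform (n×n)/(n−1) semi-Latin square with intersection parameter μ = 1. -/
open Polynomial

/-- The superposition of `n − 1` mutually orthogonal Latin squares of order `n` with
pairwise disjoint symbol sets is a uniform `(n×n)/(n−1)` semi-Latin square with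
intersection parameter `μ = 1`. (The treatments are identified with the pairs
`(t, a)`, `t` indexing the Latin squares and `a` a symbol, via the equivalence `e`.) -/
theorem superposition_MOLS_uniform (n : ℕ) (hn : 2 < n)
    (L : Fin (n - 1) → Fin n → Fin n → Fin n) (hL : IsMOLS L)
    (e : Fin (n * (n - 1)) ≃ Fin (n - 1) × Fin n) :
    ∃ S : SemiLatinSquare n (n - 1),
      (∀ (α : Fin (n * (n - 1))) (i j : Fin n),
        α ∈ S.block i j ↔ L (e α).1 i j = (e α).2) ∧
      S.UniformWith 1 := by
  classical
  obtain ⟨hLat, hOrth⟩ := hL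
  refine ⟨⟨fun i j => Finset.univ.filter fun α => L (e α).1 i j = (e α).2, ?_, ?_, ?_⟩, ?_, ?_, ?_⟩
  · intro i j
    have h : (Finset.univ.filter fun α => L (e α).1 i j = (e α).2)
        = Finset.univ.image (fun t : Fin (n - 1) => e.symm (t, L t i j)) := by
      ext α
      simp only [Finset.mem_filter, Finset.mem_univ, true_and, Finset.mem_image]
      constructor
      · intro h
        exact ⟨(e α).1, by rw [h]; simp⟩
      · rintro ⟨t, rfl⟩
        simp
    rw [h, Finset.card_image_of_injective]
    · simp
    · intro t t' h
      have := e.symm.injective h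
      exact congrArg Prod.fst this
  · intro i α
    simpa using (hLat (e α).1).1 i (e α).2
  · intro j α
    simpa using (hLat (e α).1).2 j (e α).2
  · intro α i j
    simp
  · exact Nat.one_pos
  · intro i j i' j' hi hj
    have key : ∀ t t' : Fin (n - 1), ∀ x : Fin n, L t i j = L t i' x → L t' i j = L t' i' x →
        t = t' := by
      intro t t' x h h'
      by_contra hne
      have := (hOrth t t' hne (L t i j) (L t' i j)).unique
        (y₁ := (i, j)) (y₂ := (i', x)) ⟨rfl, rfl⟩ ⟨h.symm, h'.symm⟩
      exact hi (congrArg Prod.fst this)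
    choose c hc hcu using fun t => (hLat t).1 i' (L t i j)
    have hcj : ∀ t, c t ≠ j := by
      intro t h
      have h1 := hc t
      simp only [h] at h1
      exact hi (((hLat t).2 j (L t i j)).unique rfl h1)
    let f : Fin (n - 1) → {x : Fin n // x ≠ j} := fun t => ⟨c t, hcj t⟩
    have hf : Function.Injective f := by
      intro t t' h
      have h1 : c t = c t' := congrArg Subtype.val h
      refine key t t' (c t) (hc t).symm ?_
      rw [h1]
      exact (hc t').symm
    have hb : Function.Bijective f := by
      rw [Fintype.bijective_iff_injective_and_card]
      refine ⟨hf, ?_⟩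
      simp [Fintype.card_subtype_compl]
    obtain ⟨t, ht⟩ := hb.2 ⟨j', hj.symm⟩
    have ht1 : c t = j' := congrArg Subtype.val ht
    have ht2 : L t i j = L t i' j' := by
      rw [← ht1]; exact (hc t).symm
    rw [Finset.card_eq_one]
    refine ⟨e.symm (t, L t i j), ?_⟩
    ext α
    simp only [Finset.mem_inter, Finset.mem_filter, Finset.mem_univ, true_and,
      Finset.mem_singleton]
    constructor
    · rintro ⟨h1, h2⟩
      have h3 := key t (e α).1 j' ht2 (h1.trans h2.symm)
      rw [h3, h1]
      simp
    · rintro rfl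
      simp [ht2]
end

section
/- Let n > 2 and suppose there exist n−1 mutually orthogonal Latin squares of order n. Then there exists a uniform ((n+1)×(n+1))/((n−2)n) semi-Latin square, with intersection parameter μ = n−2. -/
open Polynomial

theorem sls_of_perms (N k μ : ℕ) (hμ : 0 < μ) (hN : 1 < N) (hk : k = μ * (N - 1))
    {τ ρ : Type} [Fintype τ] [Fintype ρ] [DecidableEq ρ] (hτ : Fintype.card τ = N * k)
    (hρ : Fintype.card ρ = N) (f : τ → Equiv.Perm ρ)
    (hf : ∀ r c r' c' : ρ, r ≠ r' → c ≠ c' →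
      (Finset.univ.filter fun z : τ => f z r = c ∧ f z r' = c').card = μ) :
    ∃ S : SemiLatinSquare N k, S.UniformWith μ := by
  classical
  let e : τ ≃ Fin (N * k) := Fintype.equivFinOfCardEq hτ
  let g : ρ ≃ Fin N := Fintype.equivFinOfCardEq hρ
  have hsize : ∀ r c : ρ, (Finset.univ.filter fun z : τ => f z r = c).card = k := by
    intro r c
    have : Nontrivial ρ := Fintype.one_lt_card_iff_nontrivial.1 (by omega)
    obtain ⟨r', hr'⟩ := exists_ne r
    have h1 := Finset.card_eq_sum_card_fiberwise (f := fun z => f z r')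
      (s := Finset.univ.filter fun z : τ => f z r = c) (t := Finset.univ.erase c) (by
        intro z hz
        simp only [Finset.coe_filter, Finset.mem_univ, true_and, Set.mem_ofPred_eq] at hz
        simp only [Finset.coe_erase, Finset.coe_univ, Set.mem_sdiff, Set.mem_univ, true_and,
          Set.mem_singleton_iff]
        intro h
        exact hr' ((f z).injective (h.trans hz.symm)))
    rw [h1, Finset.sum_congr rfl (g := fun _ => μ)]
    · rw [Finset.sum_const, Finset.card_erase_of_mem (Finset.mem_univ _), Finset.card_univ, hρ, hk,
        smul_eq_mul, mul_comm]
    · intro c' hc'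
      rw [Finset.filter_filter]
      exact hf r c r' c' hr'.symm (Finset.ne_of_mem_erase hc').symm
  have hmem : ∀ (p : τ → Prop) [DecidablePred p] (α : Fin (N * k)),
      α ∈ (Finset.univ.filter p).map e.toEmbedding ↔ p (e.symm α) := by
    intro p _ α
    simp only [Finset.mem_map_equiv, Finset.mem_filter, Finset.mem_univ, true_and]
  refine ⟨⟨fun i j => (Finset.univ.filter fun z : τ => f z (g.symm i) = g.symm j).map e.toEmbedding,
    ?_, ?_, ?_⟩, hμ, ?_⟩
  · intro i j
    rw [Finset.card_map]; exact hsize _ _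
  · intro i α
    refine ⟨g (f (e.symm α) (g.symm i)), ?_, ?_⟩
    · simp only [hmem]; simp
    · intro j hj
      simp only [hmem] at hj
      rw [hj]; simp
  · intro j α
    refine ⟨g ((f (e.symm α)).symm (g.symm j)), ?_, ?_⟩
    · simp only [hmem]; simp
    · intro i hi
      simp only [hmem] at hi
      rw [← hi]; simp
  · intro i j i' j' hi hj
    show (Finset.map _ _ ∩ Finset.map _ _).card = μ
    rw [← Finset.map_inter, Finset.card_map, ← Finset.filter_and]
    exact hf _ _ _ _ (by simpa using hi) (by simpa using hj)

theorem exists_rowPerm {n : ℕ} (M : Fin n → Fin n → Fin n) (h : IsLatin n M) (a : Fin n) :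
    ∃ σ : Equiv.Perm (Fin n), ∀ i j, σ i = j ↔ M i j = a := by
  choose u hu hu' using fun i => h.1 i a
  have hinj : Function.Injective u := by
    intro i i' hii
    obtain ⟨w, -, hw⟩ := h.2 (u i) a
    rw [hw i (hu i), hw i' (by simp only [hii]; exact hu i')]
  refine ⟨Equiv.ofBijective u (Finite.injective_iff_bijective.1 hinj), fun i j => ?_⟩
  simp only [Equiv.ofBijective_apply]
  constructor
  · rintro rfl; exact hu i
  · intro h; exact (hu' i j h).symm

theorem mols_join {n : ℕ} (L : Fin (n - 1) → Fin n → Fin n → Fin n) (hL : IsMOLS L)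
    (i j i' j' : Fin n) (hi : i ≠ i') (hj : j ≠ j') :
    ∃ s, ∀ t, L t i j = L t i' j' ↔ t = s := by
  have huniq : ∀ t s v, L t i j = L t i' v → L s i j = L s i' v → t = s := by
    intro t s v ht hs
    by_contra hne
    obtain ⟨p, -, hp⟩ := hL.2 t s hne (L t i j) (L s i j)
    have h1 := hp (i, j) ⟨rfl, rfl⟩
    have h2 := hp (i', v) ⟨ht.symm, hs.symm⟩
    exact hi (congrArg Prod.fst (h1.trans h2.symm))
  choose w hw _ using fun t => (hL.1 t).1 i' (L t i j)
  have hwj : ∀ t, w t ≠ j := by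
    intro t h
    obtain ⟨x, -, hx⟩ := (hL.1 t).2 j (L t i j)
    have h' := hw t
    simp only [h] at h'
    exact hi ((hx i rfl).trans (hx i' h').symm)
  let w' : Fin (n - 1) → {x : Fin n // x ≠ j} := fun t => ⟨w t, hwj t⟩
  have hinj : Function.Injective w' := by
    intro t s hts
    have : w t = w s := congrArg Subtype.val hts
    exact huniq t s (w t) (hw t).symm (by rw [this]; exact (hw s).symm)
  have hb : Function.Bijective w' := by
    rw [Fintype.bijective_iff_injective_and_card]
    refine ⟨hinj, ?_⟩
    simp
  obtain ⟨s, hs⟩ := hb.2 ⟨j', hj.symm⟩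
  have hs' : w s = j' := congrArg Subtype.val hs
  have hss : L s i j = L s i' j' := by rw [← hs']; exact (hw s).symm
  exact ⟨s, fun t => ⟨fun h => huniq t s j' h hss, by rintro rfl; exact hss⟩⟩

theorem card_graph {A B C : Type} [Fintype A] [Fintype B] [Fintype C] (p : A × B × C → Prop)
    [DecidablePred p] (u : A → B) (v : A → C)
    (h : ∀ t a x, p (t, a, x) ↔ a = u t ∧ x = v t) :
    (Finset.univ.filter p).card = Fintype.card A := by
  classical
  rw [← Finset.card_univ]
  symm
  refine Finset.card_bij (fun t _ => (t, u t, v t)) ?_ ?_ ?_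
  · intro t _; simp [h]
  · intro t _ s _ hh; exact congrArg Prod.fst hh
  · rintro ⟨t, a, x⟩ hz
    simp only [Finset.mem_filter, Finset.mem_univ, true_and, h] at hz
    exact ⟨t, Finset.mem_univ _, by rw [hz.1, hz.2]⟩

set_option maxHeartbeats 2000000 in
/-- If `n − 1` MOLS of order `n` exist (`n > 2`), then there exists a uniform
`((n+1)×(n+1))/((n−2)n)` semi-Latin square with intersection parameter `μ = n − 2`. -/
theorem exists_uniform_sls_n_plus_one (n : ℕ) (hn : 2 < n)
    (L : Fin (n - 1) → Fin n → Fin n → Fin n) (hL : IsMOLS L) :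
    ∃ S : SemiLatinSquare (n + 1) ((n - 2) * n), S.UniformWith (n - 2) := by
  classical
  choose P hP using fun t a => exists_rowPerm (L t) (hL.1 t) a
  let t0 : Fin (n - 1) := ⟨0, by omega⟩
  let T := {t : Fin (n - 1) // t ≠ t0}
  have hT : Fintype.card T = n - 2 := by
    simp [T]; omega
  let f : T × Fin n × Option (Fin n) → Equiv.Perm (Option (Fin n)) := fun z =>
    (Equiv.swap none z.2.2).trans (Equiv.optionCongr (P (if z.2.2 = none then t0 else z.1.1) z.2.1))
  have f1 : ∀ t a, f (t, a, none) none = none := by intro t a; simp [f]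
  have f2 : ∀ t a i, f (t, a, none) (some i) = some (P t0 a i) := by intro t a i; simp [f]
  have f3 : ∀ t a y, f (t, a, some y) none = some (P t.1 a y) := by intro t a y; simp [f]
  have f4 : ∀ t a y, f (t, a, some y) (some y) = none := by intro t a y; simp [f]
  have f5 : ∀ t a y i, i ≠ y → f (t, a, some y) (some i) = some (P t.1 a i) := by
    intro t a y i h
    simp [f, Equiv.swap_apply_of_ne_of_ne, h]
  have g1 : ∀ t a x, f (t, a, x) none = none ↔ x = none := by
    intro t a x; cases x <;> simp [f1, f3]
  have g2 : ∀ t a x i, f (t, a, x) (some i) = none ↔ x = some i := by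
    intro t a x i
    cases x with
    | none => simp [f2]
    | some y =>
      by_cases h : i = y
      · subst h; simp [f4]
      · simp [f5 _ _ _ _ h, Ne.symm h]
  have g3 : ∀ t a x j, f (t, a, x) none = some j ↔ ∃ y, x = some y ∧ L t.1 y j = a := by
    intro t a x j
    cases x <;> simp [f1, f3, hP]
  have g4 : ∀ t a x i j, f (t, a, x) (some i) = some j ↔
      (x = none ∧ L t0 i j = a) ∨ (x ≠ none ∧ x ≠ some i ∧ L t.1 i j = a) := by
    intro t a x i j
    cases x with
    | none => simp [f2, hP]
    | some y =>
      by_cases h : i = y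
      · subst h; simp [f4]
      · simp [f5 _ _ _ _ h, hP, Ne.symm h]
  clear_value f
  refine sls_of_perms (n + 1) ((n - 2) * n) (n - 2) (by omega) (by omega) (by simp)
    (τ := T × Fin n × Option (Fin n)) (ρ := Option (Fin n)) ?_ (by simp) f ?_
  · simp only [Fintype.card_prod, hT, Fintype.card_option, Fintype.card_fin]; ring
  -- the cases
  have c1 : ∀ i j, (Finset.univ.filter fun z => f z none = none ∧ f z (some i) = some j).card
      = n - 2 := by
    intro i j
    rw [← hT]
    refine card_graph _ (fun _ => L t0 i j) (fun _ => none) fun t a x => ?_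
    simp only [g1, g4]
    constructor
    · rintro ⟨rfl, h⟩; simpa [eq_comm] using h
    · rintro ⟨rfl, rfl⟩; simp
  have c2 : ∀ i j, (Finset.univ.filter fun z => f z none = some j ∧ f z (some i) = none).card
      = n - 2 := by
    intro i j
    rw [← hT]
    refine card_graph _ (fun t => L t.1 i j) (fun _ => some i) fun t a x => ?_
    simp only [g2, g3]
    constructor
    · rintro ⟨⟨y, h, h'⟩, rfl⟩
      cases h
      exact ⟨h'.symm, rfl⟩
    · rintro ⟨rfl, rfl⟩; simp
  have c3 : ∀ i j j', j ≠ j' →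
      (Finset.univ.filter fun z => f z none = some j ∧ f z (some i) = some j').card = n - 2 := by
    intro i j j' hj
    rw [← hT]
    refine card_graph _ (fun t => L t.1 i j') (fun t => some ((P t.1 (L t.1 i j')).symm j))
      fun t a x => ?_
    simp only [g3, g4]
    constructor
    · rintro ⟨⟨y, rfl, h⟩, h'⟩
      have h2 : L t.1 i j' = a := by
        rcases h' with h' | h'
        · exact absurd h'.1 (by simp)
        · exact h'.2.2
      subst h2
      refine ⟨rfl, ?_⟩
      rw [← hP] at h
      rw [← h]; simp
    · rintro ⟨rfl, rfl⟩
      refine ⟨⟨_, rfl, ?_⟩, Or.inr ⟨by simp, ?_, rfl⟩⟩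
      · rw [← hP]; simp
      · intro h
        have h := Option.some.inj h
        rw [Equiv.symm_apply_eq] at h
        exact hj (h.trans ((hP _ _ _ _).2 rfl))
  have c4 : ∀ i i' j', i ≠ i' →
      (Finset.univ.filter fun z => f z (some i) = none ∧ f z (some i') = some j').card = n - 2 := by
    intro i i' j' hi
    rw [← hT]
    refine card_graph _ (fun t => L t.1 i' j') (fun _ => some i) fun t a x => ?_
    simp only [g2, g4]
    constructor
    · rintro ⟨rfl, h⟩
      obtain ⟨-, h2⟩ : _ ∧ _ := by simpa using h
      exact ⟨h2.symm, rfl⟩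
    · rintro ⟨rfl, rfl⟩; simp [hi]
  have c5 : ∀ i j i' j', i ≠ i' → j ≠ j' →
      (Finset.univ.filter fun z => f z (some i) = some j ∧ f z (some i') = some j').card
        = n - 2 := by
    intro i j i' j' hi hj
    obtain ⟨s, hs⟩ := mols_join L hL i j i' j' hi hj
    by_cases hs0 : s = t0
    · rw [← hT]
      refine card_graph _ (fun _ => L t0 i j) (fun _ => none) fun t a x => ?_
      simp only [g4]
      constructor
      · rintro ⟨h | ⟨h1, h2, h3⟩, h'⟩
        · exact ⟨h.2.symm, h.1⟩
        · exfalso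
          have h4 : L t.1 i' j' = a := by
            rcases h' with h' | h'
            · exact absurd h'.1 h1
            · exact h'.2.2
          exact t.2 (((hs t.1).1 (h3.trans h4.symm)).trans hs0)
      · rintro ⟨rfl, rfl⟩
        simp [(hs t0).2 hs0.symm]
    · have : (Finset.univ.filter fun z => f z (some i) = some j ∧ f z (some i') = some j').card
          = ((Finset.univ.erase i).erase i').card := by
        symm
        refine Finset.card_bij (fun y _ => ((⟨s, hs0⟩ : T), L s i j, some y)) ?_ ?_ ?_
        · intro y hy
          simp only [Finset.mem_erase, Finset.mem_univ, and_true] at hy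
          simp [g4, hy.1, hy.2, (hs s).2 rfl]
        · intro y _ y' _ h
          simpa using h
        · rintro ⟨t, a, x⟩ hz
          simp only [Finset.mem_filter, Finset.mem_univ, true_and, g4] at hz
          obtain ⟨h, h'⟩ := hz
          cases x with
          | none =>
            simp only [true_and, ne_eq, not_true_eq_false, false_and, or_false] at h h'
            exact absurd ((hs t0).1 (h.trans h'.symm)).symm hs0
          | some y =>
            simp only [reduceCtorEq, false_and, false_or, ne_eq, not_false_eq_true, true_and,
              Option.some.injEq] at h h'
            have hts := (hs t.1).1 (h.2.trans h'.2.symm)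
            obtain ⟨t, ht⟩ := t
            simp only at hts
            subst hts
            refine ⟨y, by simp [h.1, h'.1], ?_⟩
            simp only [h.2]
      rw [this, Finset.card_erase_of_mem (by simp [hi.symm]),
        Finset.card_erase_of_mem (by simp), Finset.card_univ, Fintype.card_fin]
      omega
  have sw : ∀ r c r' c', (Finset.univ.filter fun z => f z r' = c' ∧ f z r = c).card = n - 2 →
      (Finset.univ.filter fun z => f z r = c ∧ f z r' = c').card = n - 2 := by
    intro r c r' c' h
    rw [← h]
    congr 1
    ext z
    simp [and_comm]
  rintro (_ | r) (_ | c) (_ | r') (_ | c') hr hc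
  all_goals first
    | exact absurd rfl hr
    | exact absurd rfl hc
    | exact c1 _ _
    | exact c2 _ _
    | exact c3 _ _ _ (by simpa using hc)
    | exact c4 _ _ _ (by simpa using hr)
    | exact c5 _ _ _ _ (by simpa using hr) (by simpa using hc)
    | exact sw _ _ _ _ (c1 _ _)
    | exact sw _ _ _ _ (c2 _ _)
    | exact sw _ _ _ _ (c3 _ _ _ (by simpa using hc.symm))
    | exact sw _ _ _ _ (c4 _ _ _ (by simpa using hr.symm))
end
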